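/- arXiv:1403.3954 — 2 statements merged into one kernel-verified Lean document; each statement's English description precedes it below -/
import Mathlib

section
/- Let C₁ and C₂ be Cantor sets, Y = C₁ * C₂ their topological join, and ΣY the suspension of Y with suspension points n and p. Suppose Z is a subspace of ΣY and h : ΣZ → ΣY is a homeomorphism whose restriction to Z (identified with the image of Z × {1/2} in ΣZ) is the inclusion of Z into ΣY. Then Z is isotopic to Y inside ΣY: there exists a continuous map H : Z × [0,1] → ΣY such that H(·, 0) is the inclusion of Z into ΣY, H(·, t) is a topological embedding for every t ∈ [0,1], and H(·, 1) is a homeomorphism of Z onto Y (viewed as the image of Y × {1/2} in ΣY). -/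
open Set Filter Topology

universe u

/-- The equivalence generating the unreduced suspension: collapse `W × {0}` to a point `n`
and `W × {1}` to a point `p`. -/
def suspRel (W : Type u) : W × unitInterval → W × unitInterval → Prop := fun a b =>
  a = b ∨ (a.2 = 0 ∧ b.2 = 0) ∨ (a.2 = 1 ∧ b.2 = 1)

/-- The unreduced suspension `ΣW` of `W`, as a quotient of `W × [0,1]`. -/
def Susp (W : Type u) : Type u := Quot (suspRel W)

instance (W : Type u) [TopologicalSpace W] : TopologicalSpace (Susp W) :=
  inferInstanceAs (TopologicalSpace (Quot (suspRel W)))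

/-- The image of `(w, t)` in the suspension. -/
def suspMk (W : Type u) [TopologicalSpace W] (w : W) (t : unitInterval) : Susp W :=
  Quot.mk _ (w, t)

/-- The set `{n, p}` of the two suspension points of `ΣW` (for `W` nonempty),
i.e. the image of `W × {0, 1}`. -/
def suspPoles (W : Type u) [TopologicalSpace W] : Set (Susp W) :=
  {z | ∃ w t, z = suspMk W w t ∧ (t = 0 ∨ t = 1)}

/-- The suspension arc of `ΣW` through `w ∈ W`: the image of `{w} × [0,1]`. -/
def suspArc (W : Type u) [TopologicalSpace W] (w : W) : Set (Susp W) :=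
  {z | ∃ t, z = suspMk W w t}

/-- The equivalence generating the topological join: identify `(a,b,0) ~ (a,b',0)` and
`(a,b,1) ~ (a',b,1)`. -/
def joinRel (C₁ C₂ : Type u) : C₁ × C₂ × unitInterval → C₁ × C₂ × unitInterval → Prop :=
  fun x y =>
    x = y ∨ (x.2.2 = 0 ∧ y.2.2 = 0 ∧ x.1 = y.1) ∨ (x.2.2 = 1 ∧ y.2.2 = 1 ∧ x.2.1 = y.2.1)

/-- The topological join `C₁ * C₂`, as a quotient of `C₁ × C₂ × [0,1]`. -/
def TopJoin (C₁ C₂ : Type u) : Type u := Quot (joinRel C₁ C₂)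

instance (C₁ C₂ : Type u) [TopologicalSpace C₁] [TopologicalSpace C₂] :
    TopologicalSpace (TopJoin C₁ C₂) :=
  inferInstanceAs (TopologicalSpace (Quot (joinRel C₁ C₂)))

/-- The image of `(a, b, t)` in the join. -/
def joinMk (C₁ C₂ : Type u) [TopologicalSpace C₁] [TopologicalSpace C₂]
    (a : C₁) (b : C₂) (t : unitInterval) : TopJoin C₁ C₂ := Quot.mk _ (a, b, t)

/-- The copy of `C₁` inside `C₁ * C₂`: the image of `C₁ × C₂ × {0}`. -/
def joinC1 (C₁ C₂ : Type u) [TopologicalSpace C₁] [TopologicalSpace C₂] :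
    Set (TopJoin C₁ C₂) := {y | ∃ a b, y = joinMk C₁ C₂ a b 0}

/-- The copy of `C₂` inside `C₁ * C₂`: the image of `C₁ × C₂ × {1}`. -/
def joinC2 (C₁ C₂ : Type u) [TopologicalSpace C₁] [TopologicalSpace C₂] :
    Set (TopJoin C₁ C₂) := {y | ∃ a b, y = joinMk C₁ C₂ a b 1}

/-- The join arc from `a ∈ C₁` to `b ∈ C₂`: the image of `{(a,b)} × [0,1]`. -/
def joinArc (C₁ C₂ : Type u) [TopologicalSpace C₁] [TopologicalSpace C₂]
    (a : C₁) (b : C₂) : Set (TopJoin C₁ C₂) := {y | ∃ t, y = joinMk C₁ C₂ a b t}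

/-- A nowhere vanishing homotopy carries continuous logarithms to continuous logarithms. -/
theorem exists_log_of_homotopy {A : Type*} [TopologicalSpace A] (F : unitInterval × A → ℂ)
    (hF : Continuous F) (h0 : ∀ q, F q ≠ 0) (L : A → ℂ) (hL : Continuous L)
    (hL0 : ∀ a, Complex.exp (L a) = F (0, a)) :
    ∃ L' : A → ℂ, Continuous L' ∧ ∀ a, Complex.exp (L' a) = F (1, a) := by
  let H : C(unitInterval × A, {z : ℂ // z ≠ 0}) := ⟨fun q => ⟨F q, h0 q⟩, by fun_prop⟩
  have H0 : ∀ a, H (0, a) = (fun z : ℂ ↦ (⟨_, z.exp_ne_zero⟩ : {z : ℂ // z ≠ 0}))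
      ((⟨L, hL⟩ : C(A, ℂ)) a) := fun a => Subtype.ext (hL0 a).symm
  refine ⟨fun a => Complex.isCoveringMap_exp.liftHomotopy H ⟨L, hL⟩ H0 (1, a), by fun_prop,
    fun a => ?_⟩
  have := congrFun (Complex.isCoveringMap_exp.liftHomotopy_lifts H ⟨L, hL⟩ H0) (1, a)
  exact congrArg Subtype.val this

/-- The same statement with a real homotopy parameter. -/
theorem exists_log_of_real_homotopy {A : Type*} [TopologicalSpace A] (F : ℝ → A → ℂ)
    (hF : ContinuousOn (fun q : ℝ × A => F q.1 q.2) (Icc 0 1 ×ˢ univ))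
    (h0 : ∀ t ∈ Icc (0 : ℝ) 1, ∀ a, F t a ≠ 0)
    (h : ∃ L : A → ℂ, Continuous L ∧ ∀ a, Complex.exp (L a) = F 0 a) :
    ∃ L : A → ℂ, Continuous L ∧ ∀ a, Complex.exp (L a) = F 1 a := by
  obtain ⟨L, hL, hL0⟩ := h
  refine exists_log_of_homotopy (fun q => F q.1 q.2) ?_ (fun q => h0 _ q.1.2 _) L hL hL0
  exact hF.comp_continuous (f := fun q : unitInterval × A => ((q.1 : ℝ), q.2)) (by fun_prop)
    (fun q => ⟨q.1.2, mem_univ _⟩)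

/-- An odd map on the circle has no continuous logarithm. -/
theorem not_exists_log_of_odd (f : Circle → ℂ) (hodd : ∀ z, f (-z) = -f z) :
    ¬ ∃ L : Circle → ℂ, Continuous L ∧ ∀ z, Complex.exp (L z) = f z := by
  rintro ⟨L, hL, hLf⟩
  have key : ∀ z : Circle, ∃ n : ℤ, L (-z) - L z =
      Real.pi * Complex.I + n * (2 * Real.pi * Complex.I) := by
    intro z
    rw [← Complex.exp_eq_exp_iff_exists_int]
    rw [Complex.exp_sub, hLf, hLf, hodd, Complex.exp_pi_mul_I, neg_div, div_self]
    rw [← hLf]; exact Complex.exp_ne_zero _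
  have hconn : ∃ z : Circle, (L (-z) - L z).im = 0 := by
    let g : Circle → ℝ := fun z => (L (-z) - L z).im
    have hg : Continuous g := Complex.continuous_im.comp ((hL.comp continuous_neg).sub hL)
    have hpre : IsPreconnected (univ : Set Circle) := by
      have : range Circle.exp = univ :=
        eq_univ_of_forall fun z => ⟨Complex.arg z, Circle.exp_arg z⟩
      rw [← this]
      exact isPreconnected_range Circle.exp.continuous
    have h1 : g (-1) = - g 1 := by simp [g]
    rcases le_total (g 1) 0 with h | h
    · obtain ⟨z, -, hz⟩ := hpre.intermediate_value (mem_univ 1) (mem_univ (-1)) hg.continuousOn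
        (⟨h, by linarith⟩ : (0:ℝ) ∈ Icc _ _)
      exact ⟨z, hz⟩
    · obtain ⟨z, -, hz⟩ := hpre.intermediate_value (mem_univ (-1)) (mem_univ 1) hg.continuousOn
        (⟨by linarith, h⟩ : (0:ℝ) ∈ Icc _ _)
      exact ⟨z, hz⟩
  obtain ⟨z, hz⟩ := hconn
  obtain ⟨n, hn⟩ := key z
  rw [hn] at hz
  have h2 : Real.pi * (1 + 2 * (n : ℝ)) = 0 := by
    have : ((Real.pi : ℂ) * Complex.I + n * (2 * Real.pi * Complex.I)).im = Real.pi * (1 + 2 * (n : ℝ)) := by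
      simp; ring
    rw [← this]; exact hz
  have h3 : (1 + 2 * (n : ℝ)) = 0 := by
    rcases mul_eq_zero.1 h2 with h | h
    · exact absurd h Real.pi_ne_zero
    · exact h
  have h4 : (1 + 2 * n : ℤ) = 0 := by exact_mod_cast h3
  omega

/-- A continuous injection of the closed unit disc into the plane covers every point that can be
joined to the image of the centre without meeting the image of the unit circle. -/
theorem mem_image_closedBall_of_path (f : ℂ → ℂ) (hf : ContinuousOn f (Metric.closedBall 0 1))
    (hinj : InjOn f (Metric.closedBall 0 1)) (ρ : ℝ → ℂ) (hρ : ContinuousOn ρ (Icc 0 1))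
    (hρ0 : ρ 0 = f 0) (hav : ∀ t ∈ Icc (0:ℝ) 1, ∀ z : Circle, f z ≠ ρ t) :
    ρ 1 ∈ f '' Metric.closedBall 0 1 := by
  by_contra hcon
  have hmem : ∀ (t : ℝ) (z : Circle), |t| ≤ 1 → (t : ℂ) * z ∈ Metric.closedBall (0:ℂ) 1 := by
    intro t z ht
    simpa [Circle.norm_coe] using ht
  have s1 := exists_log_of_real_homotopy (A := Circle) (fun t z => f (t * z) - ρ 1)
    (by
      refine ContinuousOn.sub (hf.comp (by fun_prop) ?_) continuousOn_const
      rintro ⟨t, z⟩ ⟨ht, -⟩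
      exact hmem _ _ (abs_le.2 ⟨by linarith [ht.1], ht.2⟩))
    (by
      intro t ht z h
      exact hcon ⟨_, hmem t z (abs_le.2 ⟨by linarith [ht.1], ht.2⟩), sub_eq_zero.1 h⟩)
    (by
      refine ⟨fun _ => Complex.log (f 0 - ρ 1), continuous_const, fun z => ?_⟩
      rw [Complex.exp_log]; · simp
      intro h
      exact hcon ⟨0, by simp, sub_eq_zero.1 h⟩)
  have s2 := exists_log_of_real_homotopy (A := Circle) (fun t z => f z - ρ (1 - t))
    (by
      refine ContinuousOn.sub (hf.comp (by fun_prop) ?_) (hρ.comp (by fun_prop) ?_)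
      · rintro ⟨t, z⟩ -
        simp [Circle.norm_coe]
      · rintro ⟨t, z⟩ ⟨ht, -⟩
        exact ⟨by simpa using ht.2, by simpa using ht.1⟩)
    (by
      intro t ht z h
      exact hav (1 - t) ⟨by linarith [ht.2], by linarith [ht.1]⟩ z (sub_eq_zero.1 h))
    (by simpa using s1)
  have hmem2 : ∀ t ∈ Icc (0:ℝ) 1, ∀ z : Circle,
      (((1 + t)⁻¹ : ℝ) : ℂ) * z ∈ Metric.closedBall (0:ℂ) 1 ∧
      ((-(t * (1 + t)⁻¹) : ℝ) : ℂ) * z ∈ Metric.closedBall (0:ℂ) 1 := by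
    intro t ht z
    have h1 : (1 + t)⁻¹ ≤ 1 := inv_le_one_of_one_le₀ (by linarith [ht.1])
    have h0 : 0 < (1 + t)⁻¹ := inv_pos.2 (by linarith [ht.1])
    refine ⟨hmem _ _ (abs_le.2 ⟨by linarith, h1⟩), hmem _ _ (abs_le.2 ⟨?_, ?_⟩)⟩
    · nlinarith [ht.1, ht.2]
    · nlinarith [ht.1, ht.2]
  have hc : ContinuousOn (fun q : ℝ × Circle => (1 + q.1)⁻¹) (Icc 0 1 ×ˢ univ) := by
    refine ContinuousOn.inv₀ (by fun_prop) ?_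
    rintro ⟨t, z⟩ ⟨ht, -⟩
    have := ht.1
    simp only at this ⊢
    linarith
  have s3 := exists_log_of_real_homotopy (A := Circle)
    (fun t z => f (((1 + t)⁻¹ : ℝ) * z) - f ((-(t * (1 + t)⁻¹) : ℝ) * z))
    (by
      refine ContinuousOn.sub (hf.comp ?_ ?_) (hf.comp ?_ ?_)
      · exact (Complex.continuous_ofReal.comp_continuousOn hc).mul (by fun_prop)
      · rintro ⟨t, z⟩ ⟨ht, -⟩
        exact (hmem2 t ht z).1
      · exact (Complex.continuous_ofReal.comp_continuousOn
          (ContinuousOn.neg (ContinuousOn.mul (by fun_prop) hc))).mul (by fun_prop)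
      · rintro ⟨t, z⟩ ⟨ht, -⟩
        exact (hmem2 t ht z).2)
    (by
      intro t ht z h
      have h1 := hinj (hmem2 t ht z).1 (hmem2 t ht z).2 (sub_eq_zero.1 h)
      have h2 := mul_right_cancel₀ (Circle.coe_ne_zero z) h1
      have h3 : (1 + t)⁻¹ = -(t * (1 + t)⁻¹) := by exact_mod_cast h2
      have h0 : 0 < (1 + t)⁻¹ := inv_pos.2 (by linarith [ht.1])
      nlinarith [ht.1])
    (by simpa [hρ0] using s2)
  refine not_exists_log_of_odd _ ?_ s3
  intro z
  simp only [neg_sub]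
  congr 2 <;> · push_cast; norm_num

/-- Two paths crossing a rectangle in transverse directions meet. -/
theorem paths_meet (δ ℓ : ℝ → ℂ) (hδ : ContinuousOn δ (Icc 0 1)) (hℓ : ContinuousOn ℓ (Icc 0 1))
    (hl : ∀ t ∈ Icc (0:ℝ) 1, (δ 0).re ≤ (ℓ t).re) (hr : ∀ t ∈ Icc (0:ℝ) 1, (ℓ t).re ≤ (δ 1).re)
    (hb : ∀ t ∈ Icc (0:ℝ) 1, (ℓ 0).im ≤ (δ t).im) (ht : ∀ t ∈ Icc (0:ℝ) 1, (δ t).im ≤ (ℓ 1).im) :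
    ∃ s ∈ Icc (0:ℝ) 1, ∃ t ∈ Icc (0:ℝ) 1, δ s = ℓ t := by
  by_contra! hne
  let m : Circle → ℝ := fun z => max |(z : ℂ).re| |(z : ℂ).im|
  have hm0 : ∀ z, 0 < m z := by
    intro z
    by_contra! h
    have h1 : |(z : ℂ).re| ≤ 0 := (le_max_left _ _).trans h
    have h2 : |(z : ℂ).im| ≤ 0 := (le_max_right _ _).trans h
    refine Circle.coe_ne_zero z (Complex.ext ?_ ?_) <;> simpa using abs_nonpos_iff.1 ‹_›
  let X : Circle → ℝ := fun z => (z : ℂ).re / m z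
  let Y : Circle → ℝ := fun z => (z : ℂ).im / m z
  have hmc : Continuous m := by fun_prop
  have hX : Continuous X := Continuous.div (by fun_prop) hmc (fun z => (hm0 z).ne')
  have hY : Continuous Y := Continuous.div (by fun_prop) hmc (fun z => (hm0 z).ne')
  have hX1 : ∀ z, |X z| ≤ 1 := fun z => by
    rw [abs_div, abs_of_pos (hm0 z)]; exact (div_le_one (hm0 z)).2 (le_max_left _ _)
  have hY1 : ∀ z, |Y z| ≤ 1 := fun z => by
    rw [abs_div, abs_of_pos (hm0 z)]; exact (div_le_one (hm0 z)).2 (le_max_right _ _)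
  have hXY : ∀ z, |X z| = 1 ∨ |Y z| = 1 := fun z => by
    simp only [X, Y, abs_div, abs_of_pos (hm0 z)]
    rcases max_choice |(z : ℂ).re| |(z : ℂ).im| with h | h
    · left; rw [← h]; exact div_self (hm0 z).ne'
    · right; rw [← h]; exact div_self (hm0 z).ne'
  have hmem : ∀ t ∈ Icc (0:ℝ) 1, ∀ x : ℝ, |x| ≤ 1 → (1 + t * x) / 2 ∈ Icc (0:ℝ) 1 := by
    intro t ht x hx
    have := abs_le.1 hx
    constructor <;> nlinarith [ht.1, ht.2, this.1, this.2]
  have s1 := exists_log_of_real_homotopy (A := Circle)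
    (fun t z => δ ((1 + t * X z) / 2) - ℓ ((1 + t * Y z) / 2))
    (by
      refine ContinuousOn.sub (hδ.comp (by fun_prop) ?_) (hℓ.comp (by fun_prop) ?_)
      · rintro ⟨t, z⟩ ⟨ht, -⟩; exact hmem t ht _ (hX1 z)
      · rintro ⟨t, z⟩ ⟨ht, -⟩; exact hmem t ht _ (hY1 z))
    (fun t ht z => sub_ne_zero.2 (hne _ (hmem t ht _ (hX1 z)) _ (hmem t ht _ (hY1 z))))
    (by
      refine ⟨fun _ => Complex.log (δ (1 / 2) - ℓ (1 / 2)), continuous_const, fun z => ?_⟩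
      rw [Complex.exp_log]; · simp
      exact sub_ne_zero.2 (hne _ (by norm_num) _ (by norm_num)))
  have one_mem : (1:ℝ) ∈ Icc (0:ℝ) 1 := by simp
  have hmemX : ∀ z, (1 + X z) / 2 ∈ Icc (0:ℝ) 1 := fun z => by
    simpa using hmem 1 one_mem _ (hX1 z)
  have hmemY : ∀ z, (1 + Y z) / 2 ∈ Icc (0:ℝ) 1 := fun z => by
    simpa using hmem 1 one_mem _ (hY1 z)
  have s2 := exists_log_of_real_homotopy (A := Circle)
    (fun t z => (1 - t : ℝ) * (δ ((1 + X z) / 2) - ℓ ((1 + Y z) / 2))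
      + (t : ℝ) * (X z - Y z * Complex.I))
    (by
      refine ContinuousOn.add (ContinuousOn.mul (by fun_prop) (ContinuousOn.sub
        (hδ.comp (by fun_prop) ?_) (hℓ.comp (by fun_prop) ?_))) (by fun_prop)
      · rintro ⟨t, z⟩ -; exact hmemX z
      · rintro ⟨t, z⟩ -; exact hmemY z)
    (by
      intro t htt z h
      rcases eq_or_lt_of_le htt.1 with h0 | h0
      · subst h0
        refine hne _ (hmemX z) _ (hmemY z) ?_
        simpa [sub_eq_zero] using h
      have hre := congrArg Complex.re h
      have him := congrArg Complex.im h
      rw [Complex.add_re, Complex.re_ofReal_mul, Complex.re_ofReal_mul] at hre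
      rw [Complex.add_im, Complex.im_ofReal_mul, Complex.im_ofReal_mul] at him
      simp only [Complex.sub_re, Complex.sub_im, Complex.ofReal_re, Complex.ofReal_im,
        Complex.mul_re, Complex.mul_im, Complex.I_re, Complex.I_im, Complex.zero_re,
        Complex.zero_im] at hre him
      have h1t : 0 ≤ 1 - t := by linarith [htt.2]
      rcases hXY z with hx | hy
      · rcases eq_or_eq_neg_of_abs_eq hx with hx | hx
        · have := hr _ (hmemY z)
          rw [hx] at hre
          norm_num at hre
          nlinarith [mul_nonneg h1t (sub_nonneg.2 this)]
        · have := hl _ (hmemY z)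
          rw [hx] at hre
          norm_num at hre
          nlinarith [mul_nonneg h1t (sub_nonneg.2 this)]
      · rcases eq_or_eq_neg_of_abs_eq hy with hy | hy
        · have := ht _ (hmemX z)
          rw [hy] at him
          norm_num at him
          nlinarith [mul_nonneg h1t (sub_nonneg.2 this)]
        · have := hb _ (hmemX z)
          rw [hy] at him
          norm_num at him
          nlinarith [mul_nonneg h1t (sub_nonneg.2 this)])
    (by simpa using s1)
  refine not_exists_log_of_odd _ ?_ s2
  intro z
  have : m (-z) = m z := by simp [m]
  simp [X, Y, this, neg_div]
  ring

/-- The minimum over all path connected subsets of `R` joining `q` to `L` of the supremum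
of `k`. -/
noncomputable def minimax {E : Type*} [TopologicalSpace E] (R L : Set E) (k : E → ℝ) (q : E) : ℝ :=
  sInf {r | ∃ C ⊆ R, IsPathConnected C ∧ q ∈ C ∧ (C ∩ L).Nonempty ∧ ∀ c ∈ C, k c ≤ r}

theorem minimax_le_add {E : Type*} [NormedAddCommGroup E] [NormedSpace ℝ E] {R L : Set E}
    (hRc : IsCompact R) (hR : Convex ℝ R) (hL : (R ∩ L).Nonempty) {k k' : E → ℝ}
    (hk : ContinuousOn k R) {q q' : E} (hq : q ∈ R) (hq' : q' ∈ R) {ε : ℝ}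
    (h : ∀ c ∈ R, k' c ≤ k c + ε) (hseg : ∀ c ∈ segment ℝ q q', k' c ≤ k q + ε) :
    minimax R L k' q' ≤ minimax R L k q + ε := by
  rw [← sub_le_iff_le_add]
  refine le_csInf ?_ ?_
  · obtain ⟨B, hB⟩ := (hRc.image_of_continuousOn hk).bddAbove
    exact ⟨B, R, subset_rfl, hR.isPathConnected ⟨q, hq⟩, hq, hL,
      fun c hc => hB (mem_image_of_mem _ hc)⟩
  · rintro r ⟨C, hCR, hC, hqC, ⟨c₀, hc₀, hc₀L⟩, hr⟩
    rw [sub_le_iff_le_add]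
    refine csInf_le ⟨k' q', ?_⟩ ⟨C ∪ segment ℝ q q', union_subset hCR (hR.segment_subset hq hq'),
      hC.union ((convex_segment q q').isPathConnected ⟨q, left_mem_segment ℝ q q'⟩)
        ⟨q, hqC, left_mem_segment ℝ q q'⟩, Or.inr (right_mem_segment ℝ q q'),
      ⟨c₀, Or.inl hc₀, hc₀L⟩, ?_⟩
    · rintro r' ⟨C', -, -, hq'C', -, hr'⟩
      exact hr' _ hq'C'
    · rintro c (hc | hc)
      · exact (h c (hCR hc)).trans (by linarith [hr c hc])
      · exact (hseg c hc).trans (by linarith [hr q hqC])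

theorem continuousOn_minimax {P E : Type*} [TopologicalSpace P] [NormedAddCommGroup E]
    [NormedSpace ℝ E] {R L : Set E} (hRc : IsCompact R) (hR : Convex ℝ R) (hL : (R ∩ L).Nonempty)
    {k : P → E → ℝ} (hk : ContinuousOn (fun q : P × E => k q.1 q.2) (univ ×ˢ R)) :
    ContinuousOn (fun q : P × E => minimax R L (k q.1) q.2) (univ ×ˢ R) := by
  have hk1 : ∀ p, ContinuousOn (k p) R := fun p =>
    hk.comp (f := fun e => (p, e)) (by fun_prop) (fun e he => ⟨mem_univ _, he⟩)
  rintro ⟨p, q⟩ ⟨-, hq⟩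
  rw [Metric.continuousWithinAt_iff']
  intro ε hε
  obtain ⟨v, hv, hvk⟩ := hRc.mem_uniformity_of_prod (f := k) hk (mem_univ p)
    (Metric.dist_mem_uniformity (show 0 < ε / 4 by linarith))
  rw [nhdsWithin_univ] at hv
  obtain ⟨δ, hδ, hδk⟩ := Metric.continuousWithinAt_iff.1 (hk1 p q hq) (ε / 4) (by linarith)
  have hmem : v ×ˢ (Metric.ball q δ) ∈ 𝓝 (p, q) := prod_mem_nhds hv (Metric.ball_mem_nhds q hδ)
  filter_upwards [self_mem_nhdsWithin, mem_nhdsWithin_of_mem_nhds hmem]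
  rintro ⟨p', q'⟩ ⟨-, hq'⟩ ⟨hp', hqq'⟩
  simp only at hq' hp' hqq' ⊢
  have h1 : ∀ c ∈ R, |k p' c - k p c| < ε / 4 := fun c hc => hvk p' hp' c hc
  have h2 : ∀ c ∈ segment ℝ q q', |k p c - k p q| < ε / 4 := fun c hc =>
    hδk (hR.segment_subset hq hq' hc)
      ((convex_ball q δ).segment_subset (Metric.mem_ball_self hδ) hqq' hc)
  have h3 : ∀ c ∈ segment ℝ q q', |k p' c - k p c| < ε / 4 := fun c hc =>
    h1 c (hR.segment_subset hq hq' hc)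
  have e1 := minimax_le_add hRc hR hL (k := k p) (k' := k p') (hk1 p) hq hq' (ε := 3 * ε / 4)
    (fun c hc => by linarith [abs_lt.1 (h1 c hc)])
    (fun c hc => by linarith [abs_lt.1 (h2 c hc), abs_lt.1 (h3 c hc)])
  have e2 := minimax_le_add hRc hR hL (k := k p') (k' := k p) (hk1 p') hq' hq (ε := 3 * ε / 4)
    (fun c hc => by linarith [abs_lt.1 (h1 c hc)])
    (fun c hc => by
      rw [segment_symm] at hc
      linarith [abs_lt.1 (h2 c hc), abs_lt.1 (h2 q' (right_mem_segment ℝ q q')),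
        abs_lt.1 (h3 q' (right_mem_segment ℝ q q'))])
  rw [Real.dist_eq, abs_lt]
  constructor <;> linarith

/-- In a path image irreducible between its endpoints, every path connected set containing the
starting point and `w` contains everything the path visits before `w`. -/
theorem exists_first_hitting {Z : Type*} [TopologicalSpace Z] [T2Space Z] {K : Set Z} {γ : ℝ → Z}
    (hγ : ContinuousOn γ (Icc 0 1)) (hγK : ∀ x ∈ Icc (0:ℝ) 1, γ x ∈ K)
    (hirr : ∀ C ⊆ K, IsPathConnected C → γ 0 ∈ C → γ 1 ∈ C → K ⊆ C) {w : Z} (hw : w ∈ K) :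
    ∃ l ∈ Icc (0:ℝ) 1, γ l = w ∧ (∀ x ∈ Ico 0 l, γ x ≠ w) ∧
      ∀ C ⊆ K, IsPathConnected C → γ 0 ∈ C → w ∈ C → γ '' Icc 0 l ⊆ C := by
  have hpc : ∀ x ∈ Icc (0:ℝ) 1, ∀ y ∈ Icc (0:ℝ) 1, x ≤ y → IsPathConnected (γ '' Icc x y) := by
    intro x hx y hy hxy
    exact ((convex_Icc x y).isPathConnected ⟨x, by simpa⟩).image'
      (hγ.mono (Icc_subset_Icc hx.1 hy.2))
  have hsub : ∀ x ∈ Icc (0:ℝ) 1, ∀ y ∈ Icc (0:ℝ) 1, γ '' Icc x y ⊆ K := by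
    rintro x hx y hy _ ⟨t, ht, rfl⟩
    exact hγK t ⟨hx.1.trans ht.1, ht.2.trans hy.2⟩
  have h0 : (0:ℝ) ∈ Icc (0:ℝ) 1 := by simp
  have h1 : (1:ℝ) ∈ Icc (0:ℝ) 1 := by simp
  have hclosed : ∀ S : Set Z, IsClosed S → IsCompact (Icc 0 1 ∩ γ ⁻¹' S) := fun S hS =>
    isCompact_Icc.of_isClosed_subset (hγ.preimage_isClosed_of_isClosed isClosed_Icc hS)
      inter_subset_left
  have hall : ∀ v ∈ K, ∃ x ∈ Icc (0:ℝ) 1, γ x = v := by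
    intro v hv
    obtain ⟨x, hx, hxv⟩ := hirr _ (hsub 0 h0 1 h1) (hpc 0 h0 1 h1 zero_le_one) ⟨0, h0, rfl⟩
      ⟨1, h1, rfl⟩ hv
    exact ⟨x, hx, hxv⟩
  obtain ⟨x₀, hx₀, hx₀w⟩ := hall w hw
  obtain ⟨l, ⟨hl, hlw⟩, hlmin⟩ := (hclosed {w} isClosed_singleton).exists_isLeast ⟨x₀, hx₀, hx₀w⟩
  have hfirst : ∀ x ∈ Ico 0 l, γ x ≠ w := fun x hx hxw =>
    absurd (hlmin ⟨⟨hx.1, hx.2.le.trans hl.2⟩, hxw⟩) (not_le.2 hx.2)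
  refine ⟨l, hl, hlw, hfirst, ?_⟩
  rintro C hCK hC h0C hwC _ ⟨x, hx, rfl⟩
  by_contra hv
  have hx1 : x ∈ Icc (0:ℝ) 1 := ⟨hx.1, hx.2.trans hl.2⟩
  have hxl : x < l := lt_of_le_of_ne hx.2 fun h => hv (by rw [h, hlw]; exact hwC)
  have hvw : γ x ≠ w := hfirst x ⟨hx.1, hxl⟩
  obtain ⟨y, ⟨hy, hyS⟩, hymax⟩ := (hclosed {γ x, w} (toFinite _).isClosed).exists_isGreatest
    ⟨x, hx1, by simp⟩
  rcases hyS with hyv | hyw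
  · have hlast : w ∈ γ '' Icc 0 x ∪ γ '' Icc y 1 := by
      refine hirr _ (union_subset (hsub 0 h0 x hx1) (hsub y hy 1 h1)) ((hpc 0 h0 x hx1 hx.1).union
        (hpc y hy 1 h1 hy.2) ⟨γ x, ⟨x, by simp [hx.1], rfl⟩, ⟨y, by simp [hy.2], hyv⟩⟩)
        (Or.inl ⟨0, by simp [hx.1], rfl⟩) (Or.inr ⟨1, by simp [hy.2], rfl⟩) hw
    rcases hlast with ⟨t, ht, htw⟩ | ⟨t, ht, htw⟩
    · exact hfirst t ⟨ht.1, ht.2.trans_lt hxl⟩ htw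
    · have := hymax ⟨⟨hy.1.trans ht.1, ht.2⟩, Or.inr htw⟩
      have hty : t = y := le_antisymm this ht.1
      rw [hty] at htw
      exact hvw (hyv ▸ htw)
  · have hlast : γ x ∈ C ∪ γ '' Icc y 1 := by
      refine hirr _ (union_subset hCK (hsub y hy 1 h1)) (hC.union
        (hpc y hy 1 h1 hy.2) ⟨w, hwC, ⟨y, by simp [hy.2], hyw⟩⟩)
        (Or.inl h0C) (Or.inr ⟨1, by simp [hy.2], rfl⟩) (hγK x hx1)
    rcases hlast with h | ⟨t, ht, htw⟩
    · exact hv h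
    · have := hymax ⟨⟨hy.1.trans ht.1, ht.2⟩, Or.inl htw⟩
      have hty : t = y := le_antisymm this ht.1
      rw [hty] at htw
      exact hvw (htw ▸ hyw)

theorem continuousOn_of_comp_surjective {K X W : Type*} [TopologicalSpace K] [CompactSpace K]
    [TopologicalSpace X] [T2Space X] [TopologicalSpace W] {q : K → X} (hq : Continuous q)
    (hs : Function.Surjective q) {g : X → W} {U : Set X} (hU : IsOpen U)
    (hg : ContinuousOn (g ∘ q) (q ⁻¹' U)) : ContinuousOn g U :=
  ((hq.isClosedMap.isQuotientMap hq hs).continuousOn_isOpen_iff hU).2 hg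

theorem continuous_of_comp_surjective {K X W : Type*} [TopologicalSpace K] [CompactSpace K]
    [TopologicalSpace X] [T2Space X] [TopologicalSpace W] {q : K → X} (hq : Continuous q)
    (hs : Function.Surjective q) {g : X → W} (hg : Continuous (g ∘ q)) : Continuous g :=
  (hq.isClosedMap.isQuotientMap hq hs).continuous_iff.2 hg

/-- `Q` exhibits `X` as the suspension of the join of `C₁` and `C₂`, and `α`, `β`, `ξ`, `σ` are
the coordinate functions: `Q a b x s` lies at height `s` over the point of the join at
position `x` between `a` and `b`. -/
structure IsJoinSusp {C₁ C₂ X : Type*} [TopologicalSpace C₁] [TopologicalSpace C₂]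
    [TopologicalSpace X] (Q : C₁ → C₂ → ℝ → ℝ → X) (α : X → C₁) (β : X → C₂) (ξ σ : X → ℝ) :
    Prop where
  cont : Continuous fun p : C₁ × C₂ × ℝ × ℝ => Q p.1 p.2.1 p.2.2.1 p.2.2.2
  mk_coord : ∀ m, Q (α m) (β m) (ξ m) (σ m) = m
  ξ_mem : ∀ m, ξ m ∈ Icc (0 : ℝ) 1
  σ_mem : ∀ m, σ m ∈ Icc (0 : ℝ) 1
  eq_iff : ∀ a b a' b', ∀ x ∈ Icc (0 : ℝ) 1, ∀ x' ∈ Icc (0 : ℝ) 1, ∀ s ∈ Icc (0 : ℝ) 1,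
    ∀ s' ∈ Icc (0 : ℝ) 1, (Q a b x s = Q a' b' x' s' ↔
      s = s' ∧ (s = 0 ∨ s = 1 ∨ (x = x' ∧ (x = 1 ∨ a = a') ∧ (x = 0 ∨ b = b'))))
  cont_σ : Continuous σ
  cont_ξ : ContinuousOn ξ {m | σ m ∈ Ioo 0 1}
  cont_α : ContinuousOn α {m | σ m ∈ Ioo 0 1 ∧ ξ m < 1}
  cont_β : ContinuousOn β {m | σ m ∈ Ioo 0 1 ∧ 0 < ξ m}

/-- `S` exhibits `X` as the suspension of `Z`, with coordinate functions `ζ` and `τ`. -/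
structure IsSusp {Z X : Type*} [TopologicalSpace Z] [TopologicalSpace X] (S : Z → ℝ → X)
    (ζ : X → Z) (τ : X → ℝ) : Prop where
  cont : Continuous fun p : Z × ℝ => S p.1 p.2
  mk_coord : ∀ m, S (ζ m) (τ m) = m
  τ_mem : ∀ m, τ m ∈ Icc (0 : ℝ) 1
  eq_iff : ∀ z z', ∀ s ∈ Icc (0 : ℝ) 1, ∀ s' ∈ Icc (0 : ℝ) 1, (S z s = S z' s' ↔
      s = s' ∧ (s = 0 ∨ s = 1 ∨ z = z'))
  cont_τ : Continuous τ
  cont_ζ : ContinuousOn ζ {m | τ m ∈ Ioo 0 1}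

namespace IsJoinSusp

variable {C₁ C₂ X : Type*} [TopologicalSpace C₁] [TopologicalSpace C₂]
    [TopologicalSpace X] {Q : C₁ → C₂ → ℝ → ℝ → X} {α : X → C₁} {β : X → C₂} {ξ σ : X → ℝ}

theorem coord_mk (h : IsJoinSusp Q α β ξ σ) (a : C₁) (b : C₂) {x s : ℝ} (hx : x ∈ Icc (0 : ℝ) 1)
    (hs : s ∈ Icc (0 : ℝ) 1) : σ (Q a b x s) = s ∧ (s = 0 ∨ s = 1 ∨
      (ξ (Q a b x s) = x ∧ (x = 1 ∨ α (Q a b x s) = a) ∧ (x = 0 ∨ β (Q a b x s) = b))) := by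
  obtain ⟨h1, h2⟩ := (h.eq_iff _ _ _ _ _ (h.ξ_mem _) _ hx _ (h.σ_mem _) _ hs).1
    (h.mk_coord (Q a b x s))
  refine ⟨h1, ?_⟩
  rw [h1] at h2
  rcases h2 with h2 | h2 | ⟨h2, h3, h4⟩
  · exact Or.inl h2
  · exact Or.inr (Or.inl h2)
  · rw [h2] at h3 h4
    exact Or.inr (Or.inr ⟨h2, h3, h4⟩)

theorem σ_mk (h : IsJoinSusp Q α β ξ σ) (a : C₁) (b : C₂) {x s : ℝ} (hx : x ∈ Icc (0 : ℝ) 1)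
    (hs : s ∈ Icc (0 : ℝ) 1) : σ (Q a b x s) = s := (h.coord_mk a b hx hs).1

theorem coord_mk_of_Ioo (h : IsJoinSusp Q α β ξ σ) (a : C₁) (b : C₂) {x s : ℝ}
    (hx : x ∈ Icc (0 : ℝ) 1) (hs : s ∈ Ioo (0 : ℝ) 1) :
      (ξ (Q a b x s) = x ∧ (x = 1 ∨ α (Q a b x s) = a) ∧ (x = 0 ∨ β (Q a b x s) = b)) := by
  rcases (h.coord_mk a b hx (Ioo_subset_Icc_self hs)).2 with h' | h' | h'
  · exact absurd h' hs.1.ne'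
  · exact absurd h' hs.2.ne
  · exact h'

theorem ξ_mk (h : IsJoinSusp Q α β ξ σ) (a : C₁) (b : C₂) {x s : ℝ} (hx : x ∈ Icc (0 : ℝ) 1)
    (hs : s ∈ Ioo (0 : ℝ) 1) : ξ (Q a b x s) = x := (h.coord_mk_of_Ioo a b hx hs).1

theorem α_mk (h : IsJoinSusp Q α β ξ σ) (a : C₁) (b : C₂) {x s : ℝ} (hx : x ∈ Ico (0 : ℝ) 1)
    (hs : s ∈ Ioo (0 : ℝ) 1) : α (Q a b x s) = a :=
  (h.coord_mk_of_Ioo a b (Ico_subset_Icc_self hx) hs).2.1.resolve_left hx.2.ne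

theorem isOpen_interior (h : IsJoinSusp Q α β ξ σ) : IsOpen {m | σ m ∈ Ioo 0 1} :=
  isOpen_Ioo.preimage h.cont_σ

theorem isOpen_ξ_lt (h : IsJoinSusp Q α β ξ σ) : IsOpen {m | σ m ∈ Ioo 0 1 ∧ ξ m < 1} :=
  h.cont_ξ.isOpen_inter_preimage h.isOpen_interior isOpen_Iio

/-- Exchanging the two factors of the join. -/
theorem swap (h : IsJoinSusp Q α β ξ σ) :
    IsJoinSusp (fun b a x s => Q a b (1 - x) s) β α (fun m => 1 - ξ m) σ where
  cont := h.cont.comp (g := fun p : C₁ × C₂ × ℝ × ℝ => Q p.1 p.2.1 p.2.2.1 p.2.2.2)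
    (f := fun p : C₂ × C₁ × ℝ × ℝ => (p.2.1, p.1, 1 - p.2.2.1, p.2.2.2)) (by fun_prop)
  mk_coord m := by simpa using h.mk_coord m
  ξ_mem m := ⟨by linarith [(h.ξ_mem m).2], by linarith [(h.ξ_mem m).1]⟩
  σ_mem := h.σ_mem
  eq_iff a b a' b' x hx x' hx' s hs s' hs' := by
    rw [h.eq_iff _ _ _ _ _ ⟨by linarith [hx.2], by linarith [hx.1]⟩ _
      ⟨by linarith [hx'.2], by linarith [hx'.1]⟩ _ hs _ hs']
    have e1 : (1 - x = 1 - x') ↔ x = x' := by constructor <;> intro h <;> linarith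
    have e2 : (1 - x = 1) ↔ x = 0 := by constructor <;> intro h <;> linarith
    have e3 : (1 - x = 0) ↔ x = 1 := by constructor <;> intro h <;> linarith
    rw [e1, e2, e3]
    tauto
  cont_σ := h.cont_σ
  cont_ξ := continuousOn_const.sub h.cont_ξ
  cont_α := by simpa only [sub_lt_self_iff] using h.cont_β
  cont_β := by simpa only [sub_pos] using h.cont_α

theorem exists_coords [CompactSpace C₁] [CompactSpace C₂] [T2Space X] (Q : C₁ → C₂ → ℝ → ℝ → X)
    (cont : Continuous fun p : C₁ × C₂ × ℝ × ℝ => Q p.1 p.2.1 p.2.2.1 p.2.2.2)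
    (surj : ∀ m, ∃ a b, ∃ x ∈ Icc (0 : ℝ) 1, ∃ s ∈ Icc (0 : ℝ) 1, Q a b x s = m)
    (eq_iff : ∀ a b a' b', ∀ x ∈ Icc (0 : ℝ) 1, ∀ x' ∈ Icc (0 : ℝ) 1, ∀ s ∈ Icc (0 : ℝ) 1,
      ∀ s' ∈ Icc (0 : ℝ) 1, (Q a b x s = Q a' b' x' s' ↔
        s = s' ∧ (s = 0 ∨ s = 1 ∨ (x = x' ∧ (x = 1 ∨ a = a') ∧ (x = 0 ∨ b = b'))))) :
    ∃ α β ξ σ, IsJoinSusp Q α β ξ σ := by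
  choose α β ξ hξ σ hσ hm using surj
  let q : C₁ × C₂ × unitInterval × unitInterval → X := fun p => Q p.1 p.2.1 p.2.2.1 p.2.2.2
  have hq : Continuous q := cont.comp
    (g := fun p : C₁ × C₂ × ℝ × ℝ => Q p.1 p.2.1 p.2.2.1 p.2.2.2)
    (f := fun p : C₁ × C₂ × unitInterval × unitInterval =>
      (p.1, p.2.1, (p.2.2.1 : ℝ), (p.2.2.2 : ℝ))) (by fun_prop)
  have hs : Function.Surjective q := fun m =>
    ⟨(α m, β m, ⟨ξ m, hξ m⟩, ⟨σ m, hσ m⟩), hm m⟩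
  have key : ∀ p, σ (q p) = p.2.2.2 ∧ (σ (q p) = 0 ∨ σ (q p) = 1 ∨ (ξ (q p) = p.2.2.1 ∧
      (ξ (q p) = 1 ∨ α (q p) = p.1) ∧ (ξ (q p) = 0 ∨ β (q p) = p.2.1))) := fun p =>
    (eq_iff _ _ _ _ _ (hξ _) _ p.2.2.1.2 _ (hσ _) _ p.2.2.2.2).1 (hm (q p))
  have key' : ∀ p, σ (q p) ∈ Ioo 0 1 → (ξ (q p) = p.2.2.1 ∧
      (ξ (q p) = 1 ∨ α (q p) = p.1) ∧ (ξ (q p) = 0 ∨ β (q p) = p.2.1)) := by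
    intro p hp
    rcases (key p).2 with h | h | h
    · exact absurd h hp.1.ne'
    · exact absurd h hp.2.ne
    · exact h
  have cσ : Continuous σ := by
    refine continuous_of_comp_surjective hq hs ?_
    have : σ ∘ q = fun p => (p.2.2.2 : ℝ) := funext fun p => (key p).1
    rw [this]
    fun_prop
  have oσ : IsOpen {m | σ m ∈ Ioo 0 1} := isOpen_Ioo.preimage cσ
  have cξ : ContinuousOn ξ {m | σ m ∈ Ioo 0 1} := by
    refine continuousOn_of_comp_surjective hq hs oσ ?_
    refine ContinuousOn.congr (f := fun p => (p.2.2.1 : ℝ)) (by fun_prop) ?_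
    exact fun p hp => (key' p hp).1
  refine ⟨α, β, ξ, σ, cont, hm, hξ, hσ, eq_iff, cσ, cξ, ?_, ?_⟩
  · refine continuousOn_of_comp_surjective hq hs (cξ.isOpen_inter_preimage oσ isOpen_Iio) ?_
    refine ContinuousOn.congr (f := fun p => p.1) (by fun_prop) ?_
    exact fun p hp => (key' p hp.1).2.1.resolve_left (ne_of_lt hp.2)
  · refine continuousOn_of_comp_surjective hq hs (cξ.isOpen_inter_preimage oσ isOpen_Ioi) ?_
    refine ContinuousOn.congr (f := fun p => p.2.1) (by fun_prop) ?_
    exact fun p hp => (key' p hp.1).2.2.resolve_left (ne_of_gt hp.2)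

end IsJoinSusp

namespace IsSusp

variable {Z X : Type*} [TopologicalSpace Z] [TopologicalSpace X] {S : Z → ℝ → X}
    {ζ : X → Z} {τ : X → ℝ}

theorem τ_mk (h : IsSusp S ζ τ) (z : Z) {s : ℝ} (hs : s ∈ Icc (0 : ℝ) 1) : τ (S z s) = s :=
  ((h.eq_iff _ _ _ (h.τ_mem _) _ hs).1 (h.mk_coord (S z s))).1

theorem ζ_mk (h : IsSusp S ζ τ) (z : Z) {s : ℝ} (hs : s ∈ Ioo (0 : ℝ) 1) : ζ (S z s) = z := by
  have hs' := Ioo_subset_Icc_self hs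
  rcases ((h.eq_iff _ _ _ (h.τ_mem _) _ hs').1 (h.mk_coord (S z s))).2 with h' | h' | h'
  · rw [h.τ_mk z hs'] at h'
    exact absurd h' hs.1.ne'
  · rw [h.τ_mk z hs'] at h'
    exact absurd h' hs.2.ne
  · exact h'

/-- Turning the suspension upside down. -/
theorem flip (h : IsSusp S ζ τ) : IsSusp (fun z s => S z (1 - s)) ζ (fun m => 1 - τ m) where
  cont := h.cont.comp (g := fun p : Z × ℝ => S p.1 p.2)
    (f := fun p : Z × ℝ => (p.1, 1 - p.2)) (by fun_prop)
  mk_coord m := by simpa using h.mk_coord m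
  τ_mem m := ⟨by linarith [(h.τ_mem m).2], by linarith [(h.τ_mem m).1]⟩
  eq_iff z z' s hs s' hs' := by
    rw [h.eq_iff _ _ _ ⟨by linarith [hs.2], by linarith [hs.1]⟩ _
      ⟨by linarith [hs'.2], by linarith [hs'.1]⟩]
    have e1 : (1 - s = 1 - s') ↔ s = s' := by constructor <;> intro h <;> linarith
    have e2 : (1 - s = 1) ↔ s = 0 := by constructor <;> intro h <;> linarith
    have e3 : (1 - s = 0) ↔ s = 1 := by constructor <;> intro h <;> linarith
    rw [e1, e2, e3]
    tauto
  cont_τ := continuous_const.sub h.cont_τ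
  cont_ζ := by
    refine h.cont_ζ.mono fun m hm => ?_
    exact ⟨by linarith [hm.2], by linarith [hm.1]⟩

theorem exists_coords [CompactSpace Z] [T2Space X] (S : Z → ℝ → X)
    (cont : Continuous fun p : Z × ℝ => S p.1 p.2)
    (surj : ∀ m, ∃ z, ∃ s ∈ Icc (0 : ℝ) 1, S z s = m)
    (eq_iff : ∀ z z', ∀ s ∈ Icc (0 : ℝ) 1, ∀ s' ∈ Icc (0 : ℝ) 1, (S z s = S z' s' ↔
      s = s' ∧ (s = 0 ∨ s = 1 ∨ z = z'))) :
    ∃ ζ τ, IsSusp S ζ τ := by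
  choose ζ τ hτ hm using surj
  let q : Z × unitInterval → X := fun p => S p.1 p.2
  have hq : Continuous q := cont.comp (g := fun p : Z × ℝ => S p.1 p.2)
    (f := fun p : Z × unitInterval => (p.1, (p.2 : ℝ))) (by fun_prop)
  have hs : Function.Surjective q := fun m => ⟨(ζ m, ⟨τ m, hτ m⟩), hm m⟩
  have key : ∀ p, τ (q p) = p.2 ∧ (τ (q p) = 0 ∨ τ (q p) = 1 ∨ ζ (q p) = p.1) := fun p =>
    (eq_iff _ _ _ (hτ _) _ p.2.2).1 (hm (q p))
  have cτ : Continuous τ := by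
    refine continuous_of_comp_surjective hq hs ?_
    have : τ ∘ q = fun p => (p.2 : ℝ) := funext fun p => (key p).1
    rw [this]
    fun_prop
  refine ⟨ζ, τ, cont, hm, hτ, eq_iff, cτ, ?_⟩
  refine continuousOn_of_comp_surjective hq hs (isOpen_Ioo.preimage cτ) ?_
  refine ContinuousOn.congr (f := fun p => p.1) (by fun_prop) ?_
  intro p hp
  rcases (key p).2 with h | h | h
  · exact absurd h (ne_of_gt hp.1)
  · exact absurd h (ne_of_lt hp.2)
  · exact h

end IsSusp

section Rigidity

variable {C₁ C₂ X Z : Type*} [TopologicalSpace C₁] [TopologicalSpace C₂]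
    [TopologicalSpace X] [TopologicalSpace Z] {Q : C₁ → C₂ → ℝ → ℝ → X} {α : X → C₁} {β : X → C₂}
    {ξ σ : X → ℝ} {S : Z → ℝ → X} {ζ : X → Z} {τ : X → ℝ}

theorem IsJoinSusp.not_pole_of_ξ_lt (hQ : IsJoinSusp Q α β ξ σ) (hS : IsSusp S ζ τ)
    [CompactSpace Z] [TotallyDisconnectedSpace C₁] (hacc : ∀ a : C₁, (𝓝[≠] a).NeBot) (z : Z) :
    ¬ (σ (S z 0) ∈ Ioo 0 1 ∧ ξ (S z 0) < 1) := by
  intro hz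
  have hz0 : ∀ z', S z' 0 = S z 0 := fun z' =>
    (hS.eq_iff _ _ 0 (by simp) 0 (by simp)).2 ⟨rfl, Or.inl rfl⟩
  obtain ⟨u, v, -, hv, hu, h0v, huv⟩ := generalized_tube_lemma isCompact_univ
    (isCompact_singleton (x := (0 : ℝ))) (hQ.isOpen_ξ_lt.preimage hS.cont) (by
      rintro ⟨z', t⟩ ⟨-, ht⟩
      obtain rfl : t = 0 := ht
      change _ ∧ _
      simpa only [hz0] using hz)
  obtain ⟨ε, hε, hεv⟩ := Metric.isOpen_iff.1 hv 0 (h0v rfl)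
  have hG : ∀ m, τ m < ε → σ m ∈ Ioo 0 1 ∧ ξ m < 1 := by
    intro m hm
    have : (ζ m, τ m) ∈ u ×ˢ v := ⟨hu (mem_univ _), hεv (by
      rw [Metric.mem_ball, Real.dist_eq, sub_zero, abs_of_nonneg (hS.τ_mem m).1]; exact hm)⟩
    have := huv this
    change σ (S (ζ m) (τ m)) ∈ Ioo 0 1 ∧ ξ (S (ζ m) (τ m)) < 1 at this
    rwa [hS.mk_coord] at this
  have hpre : IsPreconnected {m | τ m < ε} := by
    refine isPreconnected_of_forall (S z 0) fun m hm => ?_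
    refine ⟨(fun t => S (ζ m) t) '' Icc 0 (τ m), ?_, ⟨0, by simp [(hS.τ_mem m).1], hz0 _⟩,
      ⟨τ m, by simp [(hS.τ_mem m).1], hS.mk_coord m⟩,
      isPreconnected_Icc.image _ (Continuous.continuousOn (hS.cont.comp
        (g := fun p : Z × ℝ => S p.1 p.2) (f := fun t => (ζ m, t)) (by fun_prop)))⟩
    rintro _ ⟨t, ht, rfl⟩
    simp only [mem_ofPred_eq]
    rw [hS.τ_mk _ ⟨ht.1, ht.2.trans (hS.τ_mem m).2⟩]
    exact lt_of_le_of_lt ht.2 hm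
  have hsub := (hpre.image α (hQ.cont_α.mono fun m hm => hG m hm)).subsingleton
  set m₀ := S z 0 with hm₀
  have hm₀G : τ m₀ < ε := by rw [hm₀, hS.τ_mk _ (by simp)]; exact hε
  have hc : Continuous fun a => Q a (β m₀) (ξ m₀) (σ m₀) := hQ.cont.comp
    (g := fun p : C₁ × C₂ × ℝ × ℝ => Q p.1 p.2.1 p.2.2.1 p.2.2.2)
    (f := fun a => (a, β m₀, ξ m₀, σ m₀)) (by fun_prop)
  have hev : ∀ᶠ a in 𝓝 (α m₀), τ (Q a (β m₀) (ξ m₀) (σ m₀)) < ε := by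
    refine (isOpen_Iio.preimage (hS.cont_τ.comp hc)).mem_nhds ?_
    simpa [hQ.mk_coord] using hm₀G
  have := hacc (α m₀)
  obtain ⟨a, ha, hne⟩ := ((hev.filter_mono nhdsWithin_le_nhds).and
    (self_mem_nhdsWithin (a := α m₀) (s := {α m₀}ᶜ))).exists
  refine hne ?_
  have := hsub (mem_image_of_mem α ha) (mem_image_of_mem α hm₀G)
  rwa [hQ.α_mk _ _ ⟨(hQ.ξ_mem _).1, hz.2⟩ hz.1] at this

theorem IsJoinSusp.σ_bot (hQ : IsJoinSusp Q α β ξ σ) (hS : IsSusp S ζ τ)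
    [CompactSpace Z] [TotallyDisconnectedSpace C₁] [TotallyDisconnectedSpace C₂]
    (hacc₁ : ∀ a : C₁, (𝓝[≠] a).NeBot) (hacc₂ : ∀ a : C₂, (𝓝[≠] a).NeBot) (z : Z) :
    σ (S z 0) = 0 ∨ σ (S z 0) = 1 := by
  by_contra! hne
  have hI : σ (S z 0) ∈ Ioo 0 1 := ⟨lt_of_le_of_ne (hQ.σ_mem _).1 (Ne.symm hne.1),
    lt_of_le_of_ne (hQ.σ_mem _).2 hne.2⟩
  rcases lt_or_ge (ξ (S z 0)) 1 with h | h
  · exact hQ.not_pole_of_ξ_lt hS hacc₁ z ⟨hI, h⟩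
  · exact hQ.swap.not_pole_of_ξ_lt hS hacc₂ z ⟨hI, by linarith⟩

theorem IsJoinSusp.eq_of_σ_eq_pole (hQ : IsJoinSusp Q α β ξ σ) {m m' : X} (h : σ m = σ m')
    (h' : σ m = 0 ∨ σ m = 1) : m = m' := by
  rw [← hQ.mk_coord m, ← hQ.mk_coord m']
  exact (hQ.eq_iff _ _ _ _ _ (hQ.ξ_mem _) _ (hQ.ξ_mem _) _ (hQ.σ_mem _) _ (hQ.σ_mem _)).2
    ⟨h, by tauto⟩

/-- After possibly turning it upside down, any other suspension structure has the same poles. -/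
theorem IsJoinSusp.exists_same_poles (hQ : IsJoinSusp Q α β ξ σ) (hS : IsSusp S ζ τ)
    [CompactSpace Z] [TotallyDisconnectedSpace C₁] [TotallyDisconnectedSpace C₂]
    (hacc₁ : ∀ a : C₁, (𝓝[≠] a).NeBot) (hacc₂ : ∀ a : C₂, (𝓝[≠] a).NeBot) :
    ∃ S' τ', IsSusp S' ζ τ' ∧ (∀ z, S' z (1 / 2) = S z (1 / 2)) ∧ (∀ z, σ (S' z 0) = 0) ∧
      ∀ z, σ (S' z 1) = 1 := by
  have h0 := hQ.σ_bot hS hacc₁ hacc₂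
  have h1 : ∀ z, σ (S z 1) = 0 ∨ σ (S z 1) = 1 := by
    simpa using hQ.σ_bot hS.flip hacc₁ hacc₂
  have hne : ∀ z z', σ (S z 0) ≠ σ (S z' 1) := by
    intro z z' h
    have := ((hS.eq_iff _ _ 0 (by simp) 1 (by simp)).1 (hQ.eq_of_σ_eq_pole h (h0 z))).1
    exact zero_ne_one this
  by_cases hz : ∀ z, σ (S z 0) = 0
  · exact ⟨S, τ, hS, fun _ => rfl, hz, fun z => (h1 z).resolve_left fun h =>
      hne z z ((hz z).trans h.symm)⟩
  · push Not at hz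
    obtain ⟨z₀, hz₀⟩ := hz
    have h01 : σ (S z₀ 0) = 1 := (h0 z₀).resolve_left hz₀
    have e1 : ∀ z, σ (S z 1) = 0 := fun z => (h1 z).resolve_right fun h =>
      hne z₀ z (h01.trans h.symm)
    refine ⟨_, _, hS.flip, fun z => by norm_num, fun z => by simpa using e1 z, fun z => ?_⟩
    simpa using (h0 z).resolve_left fun h => hne z z (h.trans (e1 z).symm)

theorem IsJoinSusp.σ_line_mem_Ioo (hQ : IsJoinSusp Q α β ξ σ) (hS : IsSusp S ζ τ)
    (hb : ∀ z, σ (S z 0) = 0) (ht : ∀ z, σ (S z 1) = 1) (z : Z) {s : ℝ} (hs : s ∈ Ioo (0 : ℝ) 1) :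
    σ (S z s) ∈ Ioo 0 1 := by
  have hs' := Ioo_subset_Icc_self hs
  refine ⟨lt_of_le_of_ne (hQ.σ_mem _).1 fun h => ?_, lt_of_le_of_ne (hQ.σ_mem _).2 fun h => ?_⟩
  · have := hQ.eq_of_σ_eq_pole (m := S z 0) (m' := S z s) ((hb z).trans h) (Or.inl (hb z))
    exact hs.1.ne ((hS.eq_iff _ _ 0 (by simp) s hs').1 this).1
  · have := hQ.eq_of_σ_eq_pole (m := S z s) (m' := S z 1) (h.trans (ht z).symm) (Or.inr h)
    exact hs.2.ne ((hS.eq_iff _ _ s hs' 1 (by simp)).1 this).1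

theorem IsSusp.τ_mem_Ioo (hS : IsSusp S ζ τ)
    (hb : ∀ z, σ (S z 0) = 0) (ht : ∀ z, σ (S z 1) = 1) {m : X} (hm : σ m ∈ Ioo 0 1) :
    τ m ∈ Ioo 0 1 := by
  refine ⟨lt_of_le_of_ne (hS.τ_mem _).1 fun h => ?_, lt_of_le_of_ne (hS.τ_mem _).2 fun h => ?_⟩
  · have e : S (ζ m) 0 = m := by
      conv_rhs => rw [← hS.mk_coord m, ← h]
    have := hb (ζ m)
    rw [e] at this
    exact hm.1.ne' this
  · have e : S (ζ m) 1 = m := by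
      conv_rhs => rw [← hS.mk_coord m, h]
    have := ht (ζ m)
    rw [e] at this
    exact hm.2.ne this

/-- Three pages of a book do not embed in the plane: no injective continuous map defined near a
point of the binding `ξ = 0` takes values in the region `0 < ξ < 1`. -/
theorem IsJoinSusp.not_injOn_of_binding (hQ : IsJoinSusp Q α β ξ σ) [TotallyDisconnectedSpace C₁]
    [Infinite C₂] {m₀ : X} (hσ : σ m₀ ∈ Ioo 0 1) (hξ : ξ m₀ = 0) {Ψ : X → X} {W : Set X}
    (hW : IsOpen W) (hm₀ : m₀ ∈ W) (hΨ : ContinuousOn Ψ W)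
    (hΨW : ∀ m ∈ W, σ (Ψ m) ∈ Ioo 0 1 ∧ ξ (Ψ m) ∈ Ioo 0 1)
    (hinj : InjOn Ψ W) [TotallyDisconnectedSpace C₂] : False := by
  obtain ⟨b₁, b₂, b₃, h12, h13, h23⟩ : ∃ b₁ b₂ b₃ : C₂, b₁ ≠ b₂ ∧ b₁ ≠ b₃ ∧ b₂ ≠ b₃ := by
    obtain ⟨f⟩ : Nonempty (ℕ ↪ C₂) := ⟨Infinite.natEmbedding C₂⟩
    exact ⟨f 0, f 1, f 2, by simp, by simp, by simp⟩
  set a := α m₀ with ha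
  set s₀ := σ m₀ with hs₀
  have hcQ : ∀ b, Continuous fun p : ℝ × ℝ => Q a b p.1 p.2 := fun b => hQ.cont.comp
    (g := fun p : C₁ × C₂ × ℝ × ℝ => Q p.1 p.2.1 p.2.2.1 p.2.2.2)
    (f := fun p : ℝ × ℝ => (a, b, p.1, p.2)) (by fun_prop)
  have hbase : ∀ b, Q a b 0 s₀ = m₀ := by
    intro b
    rw [← hQ.mk_coord m₀, ← ha, ← hs₀, hξ]
    exact (hQ.eq_iff _ _ _ _ 0 (by simp) 0 (by simp) _ (hQ.σ_mem _) _ (hQ.σ_mem _)).2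
      ⟨rfl, Or.inr (Or.inr ⟨rfl, Or.inr rfl, Or.inl rfl⟩)⟩
  have hnhd : ∀ b, ∀ᶠ p in 𝓝 ((0 : ℝ), s₀), Q a b p.1 p.2 ∈ W := fun b =>
    (hW.preimage (hcQ b)).mem_nhds (by simpa [hbase] using hm₀)
  have hnhd' : ∀ᶠ p in 𝓝 ((0 : ℝ), s₀), p.1 < 1 ∧ p.2 ∈ Ioo (0 : ℝ) 1 :=
    (isOpen_Iio.preimage continuous_fst |>.inter (isOpen_Ioo.preimage continuous_snd)).mem_nhds
      ⟨by simp, hσ⟩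
  obtain ⟨δ, hδ, hδW⟩ := Metric.eventually_nhds_iff_ball.1
    (((hnhd b₁).and (hnhd b₂)).and ((hnhd b₃).and hnhd'))
  set ε := δ / 2 with hε
  have hε0 : 0 < ε := by positivity
  have hsmall : ∀ x y : ℝ, |x| ≤ 1 → |y| ≤ 1 → (ε * x, s₀ + ε * y) ∈ Metric.ball ((0 : ℝ), s₀) δ := by
    intro x y hx hy
    rw [Metric.mem_ball, Prod.dist_eq, max_lt_iff, Real.dist_eq, Real.dist_eq]
    simp only [sub_zero, add_sub_cancel_left, abs_mul, abs_of_pos hε0]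
    constructor <;> nlinarith
  have hbox : ∀ b, b = b₁ ∨ b = b₂ ∨ b = b₃ → ∀ x y : ℝ, |x| ≤ 1 → |y| ≤ 1 →
      Q a b (ε * x) (s₀ + ε * y) ∈ W := by
    intro b hb x y hx hy
    have := hδW _ (hsmall x y hx hy)
    rcases hb with rfl | rfl | rfl
    · exact this.1.1
    · exact this.1.2
    · exact this.2.1
  have hxI : ∀ x : ℝ, x ∈ Icc (0 : ℝ) 1 → ε * x ∈ Icc (0 : ℝ) 1 := by
    intro x hx
    have := (hδW _ (hsmall x 0 (abs_le.2 ⟨by linarith [hx.1], hx.2⟩) (by simp))).2.2.1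
    exact ⟨mul_nonneg hε0.le hx.1, this.le⟩
  have hsI : ∀ y : ℝ, |y| ≤ 1 → s₀ + ε * y ∈ Ioo (0 : ℝ) 1 := fun y hy =>
    (hδW _ (hsmall 0 y (by simp) hy)).2.2.2
  have heq : ∀ b b' x x' y y', x ∈ Icc (0 : ℝ) 1 → x' ∈ Icc (0 : ℝ) 1 → |y| ≤ 1 → |y'| ≤ 1 →
      Q a b (ε * x) (s₀ + ε * y) = Q a b' (ε * x') (s₀ + ε * y') →
      y = y' ∧ x = x' ∧ (x = 0 ∨ b = b') := by
    intro b b' x x' y y' hx hx' hy hy' h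
    obtain ⟨e1, e2⟩ := (hQ.eq_iff _ _ _ _ _ (hxI x hx) _ (hxI x' hx') _
      (Ioo_subset_Icc_self (hsI y hy)) _ (Ioo_subset_Icc_self (hsI y' hy'))).1 h
    obtain ⟨e3, -, e4⟩ := (e2.resolve_left (hsI y hy).1.ne').resolve_left (hsI y hy).2.ne
    refine ⟨mul_left_cancel₀ hε0.ne' (by linarith), mul_left_cancel₀ hε0.ne' e3, ?_⟩
    exact e4.imp_left fun h => (mul_eq_zero.1 h).resolve_left hε0.ne'
  let cl : ℝ → ℝ := fun y => max (-1) (min 1 y)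
  have hcl : ∀ y, |cl y| ≤ 1 := fun y => abs_le.2
    ⟨le_max_left _ _, max_le (by norm_num) (min_le_left _ _)⟩
  have hcl' : ∀ y, |y| ≤ 1 → cl y = y := fun y hy => by
    simp [cl, min_eq_right (abs_le.1 hy).2, max_eq_right (abs_le.1 hy).1]
  let D : ℂ → X := fun w => if 0 ≤ w.re then Q a b₁ (ε * |w.re|) (s₀ + ε * cl w.im)
    else Q a b₂ (ε * |w.re|) (s₀ + ε * cl w.im)
  have hD : ∀ w : ℂ, D w = Q a (if 0 ≤ w.re then b₁ else b₂) (ε * |w.re|) (s₀ + ε * cl w.im) := by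
    intro w; simp only [D]; split_ifs <;> rfl
  have hDc : Continuous D := by
    refine Continuous.if_le ((hcQ b₁).comp (by fun_prop : Continuous fun w : ℂ =>
      (ε * |w.re|, s₀ + ε * cl w.im))) ((hcQ b₂).comp (by fun_prop : Continuous fun w : ℂ =>
      (ε * |w.re|, s₀ + ε * cl w.im))) (by fun_prop) (by fun_prop) ?_
    intro w hw
    have hsw := Ioo_subset_Icc_self (hsI _ (hcl w.im))
    rw [← hw, abs_zero, mul_zero]
    exact (hQ.eq_iff _ _ _ _ _ (by simp) _ (by simp) _ hsw _ hsw).2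
      ⟨rfl, Or.inr (Or.inr ⟨rfl, Or.inr rfl, Or.inl rfl⟩)⟩
  let ρ : ℝ → X := fun t => Q a b₃ (ε * t) (s₀ + ε * 0)
  have hρc : Continuous ρ := (hcQ b₃).comp (by fun_prop : Continuous fun t : ℝ =>
      (ε * t, s₀ + ε * 0))
  have hball : ∀ w ∈ Metric.closedBall (0:ℂ) 1, |w.re| ≤ 1 ∧ |w.im| ≤ 1 := by
    intro w hw
    rw [mem_closedBall_zero_iff] at hw
    exact ⟨(Complex.abs_re_le_norm w).trans hw, (Complex.abs_im_le_norm w).trans hw⟩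
  let T := D '' Metric.closedBall 0 1 ∪ ρ '' Icc 0 1
  have hρ0 : ρ 0 = D 0 := by simp [ρ, hD, cl, hbase]
  have hTpre : IsPreconnected T := by
    refine IsPreconnected.union (D 0) ⟨0, by simp, rfl⟩ ⟨0, by simp, hρ0⟩
      ((convex_closedBall 0 1).isPreconnected.image _ hDc.continuousOn)
      (isPreconnected_Icc.image _ hρc.continuousOn)
  have hTW : T ⊆ W := by
    rintro _ (⟨w, hw, rfl⟩ | ⟨t, ht, rfl⟩)
    · rw [hD]
      refine hbox _ ?_ _ _ (by simpa using (hball w hw).1) (hcl _)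
      split_ifs <;> simp
    · exact hbox _ (by simp) _ _ (abs_le.2 ⟨by linarith [ht.1], ht.2⟩) (by simp)
  have hαsub := (hTpre.image (α ∘ Ψ) (hQ.cont_α.comp (hΨ.mono hTW)
    fun m hm => ⟨(hΨW m (hTW hm)).1, (hΨW m (hTW hm)).2.2⟩)).subsingleton
  have hβsub := (hTpre.image (β ∘ Ψ) (hQ.cont_β.comp (hΨ.mono hTW)
    fun m hm => ⟨(hΨW m (hTW hm)).1, (hΨW m (hTW hm)).2.1⟩)).subsingleton
  let φ : X → ℂ := fun m => ⟨ξ (Ψ m), σ (Ψ m)⟩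
  have hφinj : InjOn φ T := by
    intro m hm m' hm' h
    refine hinj (hTW hm) (hTW hm') ?_
    have h1 : ξ (Ψ m) = ξ (Ψ m') := congrArg Complex.re h
    have h2 : σ (Ψ m) = σ (Ψ m') := congrArg Complex.im h
    have h3 : α (Ψ m) = α (Ψ m') := hαsub (mem_image_of_mem (α ∘ Ψ) hm)
      (mem_image_of_mem (α ∘ Ψ) hm')
    have h4 : β (Ψ m) = β (Ψ m') := hβsub (mem_image_of_mem (β ∘ Ψ) hm)
      (mem_image_of_mem (β ∘ Ψ) hm')
    rw [← hQ.mk_coord (Ψ m), ← hQ.mk_coord (Ψ m'), h1, h2, h3, h4]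
  have hφc : ContinuousOn φ W := by
    have c1 : ContinuousOn (fun m => ξ (Ψ m)) W := hQ.cont_ξ.comp hΨ fun m hm => (hΨW m hm).1
    have c2 : ContinuousOn (fun m => σ (Ψ m)) W := hQ.cont_σ.comp_continuousOn hΨ
    have : ContinuousOn (fun m => (ξ (Ψ m) : ℂ) + (σ (Ψ m) : ℂ) * Complex.I) W :=
      (Complex.continuous_ofReal.comp_continuousOn c1).add
        ((Complex.continuous_ofReal.comp_continuousOn c2).mul continuousOn_const)
    refine this.congr fun m _ => ?_
    simp [φ, Complex.ext_iff]
  have hDT : ∀ w ∈ Metric.closedBall (0:ℂ) 1, D w ∈ T := fun w hw => Or.inl ⟨w, hw, rfl⟩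
  have hρT : ∀ t ∈ Icc (0:ℝ) 1, ρ t ∈ T := fun t ht => Or.inr ⟨t, ht, rfl⟩
  have hmix : ∀ w ∈ Metric.closedBall (0:ℂ) 1, ∀ t ∈ Icc (0:ℝ) 1, D w = ρ t →
      w.im = 0 ∧ w.re = 0 ∧ t = 0 := by
    intro w hw t ht h
    rw [hD, hcl' _ (hball w hw).2] at h
    obtain ⟨e1, e2, e3⟩ := heq _ _ _ _ _ _ ⟨abs_nonneg _, (hball w hw).1⟩ ht (hball w hw).2
      (by simp) h
    have e4 : |w.re| = 0 := e3.resolve_right (by split_ifs <;> assumption)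
    exact ⟨e1, abs_eq_zero.1 e4, e2.symm.trans e4⟩
  obtain ⟨w, hw, hw1⟩ := mem_image_closedBall_of_path (φ ∘ D)
    (hφc.comp hDc.continuousOn fun w hw => hTW (hDT w hw)) (by
      refine hφinj.comp ?_ fun w hw => hDT w hw
      intro w hw w' hw' h
      rw [hD, hD, hcl' _ (hball w hw).2, hcl' _ (hball w' hw').2] at h
      obtain ⟨e1, e2, e3⟩ := heq _ _ _ _ _ _ ⟨abs_nonneg _, (hball w hw).1⟩
        ⟨abs_nonneg _, (hball w' hw').1⟩ (hball w hw).2 (hball w' hw').2 h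
      refine Complex.ext ?_ e1
      rcases e3 with e3 | e3
      · rw [abs_eq_zero.1 e3, abs_eq_zero.1 (e2.symm.trans e3)]
      · by_cases p : 0 ≤ w.re <;> by_cases p' : 0 ≤ w'.re
        · rwa [abs_of_nonneg p, abs_of_nonneg p'] at e2
        · simp [p, p', h12] at e3
        · simp [p, p', h12.symm] at e3
        · rw [abs_of_neg (not_le.1 p), abs_of_neg (not_le.1 p')] at e2
          linarith)
    (φ ∘ ρ) (hφc.comp hρc.continuousOn fun t ht => hTW (hρT t ht)) (congrArg φ hρ0) (by
      intro t ht z h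
      have hz : (z : ℂ) ∈ Metric.closedBall (0:ℂ) 1 := by simp [Circle.norm_coe]
      obtain ⟨e1, e2, -⟩ := hmix z hz t ht (hφinj (hDT z hz) (hρT t ht) h)
      exact Circle.coe_ne_zero z (Complex.ext e2 e1))
  exact one_ne_zero (hmix w hw 1 (by simp) (hφinj (hDT w hw) (hρT 1 (by simp)) hw1)).2.2

theorem IsJoinSusp.ξ_line_not_mem_Ioo (hQ : IsJoinSusp Q α β ξ σ) (hS : IsSusp S ζ τ)
    [TotallyDisconnectedSpace C₁] [TotallyDisconnectedSpace C₂] [Infinite C₂]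
    (hb : ∀ z, σ (S z 0) = 0) (ht : ∀ z, σ (S z 1) = 1) (z : Z) {s s' : ℝ}
    (hs : s ∈ Ioo (0 : ℝ) 1) (hs' : s' ∈ Ioo (0 : ℝ) 1) (h : ξ (S z s) = 0) :
    ξ (S z s') ∉ Ioo 0 1 := by
  intro h'
  set k := s' * (1 - s) / (s * (1 - s')) with hk
  have p1 : 0 < 1 - s := by linarith [hs.2]
  have p2 : 0 < 1 - s' := by linarith [hs'.2]
  have hk0 : 0 < k := div_pos (mul_pos hs'.1 p1) (mul_pos hs.1 p2)
  let g : ℝ → ℝ := fun t => t * k / (t * k + (1 - t))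
  have hden : ∀ t ∈ Ioo (0:ℝ) 1, 0 < t * k + (1 - t) := fun t ht => by
    nlinarith [ht.1, ht.2, mul_pos ht.1 hk0]
  have hg : ∀ t ∈ Ioo (0:ℝ) 1, g t ∈ Ioo (0:ℝ) 1 := fun t ht =>
    ⟨div_pos (mul_pos ht.1 hk0) (hden t ht), (div_lt_one (hden t ht)).2 (by linarith [ht.2])⟩
  have hginj : ∀ t ∈ Ioo (0:ℝ) 1, ∀ t' ∈ Ioo (0:ℝ) 1, g t = g t' → t = t' := by
    intro t ht t' ht' h
    have := (div_eq_div_iff (hden t ht).ne' (hden t' ht').ne').1 h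
    exact mul_left_cancel₀ hk0.ne' (by linarith)
  have hgs : g s = s' := by
    simp only [g]
    rw [div_eq_iff (hden s hs).ne', hk]
    have := hs.1.ne'
    field_simp
    ring
  let Ψ : X → X := fun m => S (ζ m) (g (τ m))
  have oτ : IsOpen {m | τ m ∈ Ioo 0 1} := isOpen_Ioo.preimage hS.cont_τ
  have hgc : ContinuousOn (fun m => g (τ m)) {m | τ m ∈ Ioo 0 1} := by
    have := hS.cont_τ
    exact ContinuousOn.div (by fun_prop) (by fun_prop) fun m hm => (hden _ hm).ne'
  have hΨ : ContinuousOn Ψ {m | τ m ∈ Ioo 0 1} :=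
    hS.cont.comp_continuousOn (hS.cont_ζ.prodMk hgc)
  have oreg : IsOpen {m | σ m ∈ Ioo 0 1 ∧ ξ m ∈ Ioo 0 1} :=
    hQ.cont_ξ.isOpen_inter_preimage hQ.isOpen_interior isOpen_Ioo
  have hW := hΨ.isOpen_inter_preimage oτ oreg
  refine hQ.not_injOn_of_binding (m₀ := S z s) (hQ.σ_line_mem_Ioo hS hb ht z hs) h hW ?_
    (hΨ.mono inter_subset_left) (fun m hm => hm.2) ?_
  · refine ⟨?_, ?_⟩
    · simpa only [mem_ofPred_eq, hS.τ_mk z (Ioo_subset_Icc_self hs)] using hs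
    · simp only [Ψ, mem_preimage, hS.τ_mk z (Ioo_subset_Icc_self hs), hS.ζ_mk z hs, hgs]
      exact ⟨hQ.σ_line_mem_Ioo hS hb ht z hs', h'⟩
  · rintro m ⟨hm, -⟩ m' ⟨hm', -⟩ heq
    simp only [mem_ofPred_eq] at hm hm'
    have e1 := congrArg τ heq
    have e2 := congrArg ζ heq
    simp only [Ψ] at e1 e2
    rw [hS.τ_mk _ (Ioo_subset_Icc_self (hg _ hm)), hS.τ_mk _ (Ioo_subset_Icc_self (hg _ hm'))] at e1
    rw [hS.ζ_mk _ (hg _ hm), hS.ζ_mk _ (hg _ hm')] at e2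
    rw [← hS.mk_coord m, ← hS.mk_coord m', e2, hginj _ hm _ hm' e1]

end Rigidity

section Parametrization

/-- The minimax value at a point of an irreducible path image is the maximum over the part of the
path up to its first visit to that point. -/
theorem minimax_eq_sSup {E Z : Type*} [TopologicalSpace E] [TopologicalSpace Z] [T2Space Z]
    {R L : Set E} {K : Set Z} {co : Z → E} {π : E → Z} {γ : ℝ → Z} (hco : Continuous co)
    (hcoR : ∀ z, co z ∈ R) (hπ : ContinuousOn π R) (hπK : ∀ e ∈ R, π e ∈ K)
    (hπco : ∀ w ∈ K, π (co w) = w) (hπL : ∀ e ∈ R ∩ L, π e = γ 0) (hL : co (γ 0) ∈ L)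
    (hγ : ContinuousOn γ (Icc 0 1)) (hγK : ∀ x ∈ Icc (0:ℝ) 1, γ x ∈ K) {l : ℝ}
    (hl : l ∈ Icc (0:ℝ) 1)
    (hmin : ∀ C ⊆ K, IsPathConnected C → γ 0 ∈ C → γ l ∈ C → γ '' Icc 0 l ⊆ C) {k : Z → ℝ}
    (hk : BddAbove (range k)) :
    minimax R L (fun e => k (π e)) (co (γ l)) = sSup (k '' (γ '' Icc 0 l)) := by
  have hsub : γ '' Icc 0 l ⊆ K := by
    rintro _ ⟨t, ht, rfl⟩
    exact hγK t ⟨ht.1, ht.2.trans hl.2⟩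
  have h0 : γ 0 ∈ γ '' Icc 0 l := ⟨0, by simp [hl.1], rfl⟩
  rw [← csInf_upperBounds_eq_csSup, minimax]
  · congr 1
    ext r
    constructor
    · rintro ⟨C, hCR, hC, hqC, ⟨c₀, hc₀, hc₀L⟩, hr⟩
      have := hmin (π '' C) (image_subset_iff.2 fun e he => hπK e (hCR he))
        (hC.image' (hπ.mono hCR)) ⟨c₀, hc₀, hπL c₀ ⟨hCR hc₀, hc₀L⟩⟩
        ⟨_, hqC, hπco _ (hγK l hl)⟩
      rintro _ ⟨z, hz, rfl⟩
      obtain ⟨c, hc, rfl⟩ := this hz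
      exact hr c hc
    · intro hr
      refine ⟨co '' (γ '' Icc 0 l), ?_, ?_, ⟨γ l, ⟨l, by simp [hl.1], rfl⟩, rfl⟩,
        ⟨_, ⟨_, h0, rfl⟩, hL⟩, ?_⟩
      · rintro _ ⟨z, -, rfl⟩
        exact hcoR z
      · exact (((convex_Icc 0 l).isPathConnected ⟨0, by simp [hl.1]⟩).image'
          (hγ.mono (Icc_subset_Icc le_rfl hl.2))).image hco
      · rintro _ ⟨z, hz, rfl⟩
        rw [hπco z (hsub hz)]
        exact hr (mem_image_of_mem k hz)
  · exact hk.mono (image_subset_range _ _)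
  · exact ⟨_, mem_image_of_mem k h0⟩

theorem exists_seq_real_separating (Z : Type*) [TopologicalSpace Z] [CompactSpace Z]
    [TopologicalSpace.MetrizableSpace Z] [Nonempty Z] :
    ∃ (k : ℕ → Z → ℝ) (D : ℝ), (∀ n, Continuous (k n)) ∧ (∀ n z, k n z ∈ Icc (-D) 0) ∧
      ∀ C : Set Z, IsCompact C → C.Nonempty → ∀ w ∉ C, ∃ n r, (∀ c ∈ C, k n c ≤ r) ∧ r < k n w := by
  let _ := TopologicalSpace.metrizableSpaceMetric Z
  refine ⟨fun n z => -dist (TopologicalSpace.denseSeq Z n) z, Metric.diam (univ : Set Z),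
    fun n => by fun_prop, fun n z => ⟨neg_le_neg (Metric.dist_le_diam_of_mem
      isCompact_univ.isBounded (mem_univ _) (mem_univ _)), by simp⟩, fun C hC hne w hw => ?_⟩
  have hpos := (hC.isClosed.notMem_iff_infDist_pos hne).1 hw
  obtain ⟨n, hn⟩ := (TopologicalSpace.denseRange_denseSeq Z).exists_dist_lt w (half_pos hpos)
  refine ⟨n, -(Metric.infDist w C / 2), fun z hz => ?_, ?_⟩
  · have h1 := Metric.infDist_le_dist_of_mem (x := w) hz
    have h2 := dist_triangle w (TopologicalSpace.denseSeq Z n) z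
    linarith
  · simp only [dist_comm _ w]
    linarith

/-- A family of irreducible path images `K p` carries a continuous family of functions which
strictly increase from the initial to the final point. -/
theorem exists_monotone_family {P Z E : Type*} [TopologicalSpace P] [TopologicalSpace Z]
    [CompactSpace Z] [TopologicalSpace.MetrizableSpace Z] [Nonempty Z] [NormedAddCommGroup E]
    [NormedSpace ℝ E] {R L : Set E} (hRc : IsCompact R) (hR : Convex ℝ R) (hRL : (R ∩ L).Nonempty)
    {K : P → Set Z} {co : Z → E} (hco : Continuous co) (hcoR : ∀ z, co z ∈ R) {π : P → E → Z}
    (hπ : ContinuousOn (fun q : P × E => π q.1 q.2) (univ ×ˢ R))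
    (hπK : ∀ p, ∀ e ∈ R, π p e ∈ K p) (hπco : ∀ p, ∀ w ∈ K p, π p (co w) = w) {γ : P → ℝ → Z}
    (hπL : ∀ p, ∀ e ∈ R ∩ L, π p e = γ p 0) (hL : ∀ p, co (γ p 0) ∈ L)
    (hγ : ∀ p, ContinuousOn (γ p) (Icc 0 1)) (hγK : ∀ p, ∀ x ∈ Icc (0:ℝ) 1, γ p x ∈ K p)
    (hirr : ∀ p, ∀ C ⊆ K p, IsPathConnected C → γ p 0 ∈ C → γ p 1 ∈ C → K p ⊆ C) :
    ∃ u : P → Z → ℝ, Continuous (fun q : P × Z => u q.1 q.2) ∧ ∀ p, InjOn (u p) (K p) ∧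
      ∀ w ∈ K p, u p (γ p 0) ≤ u p w ∧ u p w ≤ u p (γ p 1) := by
  obtain ⟨k, D, hkc, hkI, hksep⟩ := exists_seq_real_separating Z
  have hkb : ∀ n, BddAbove (range (k n)) := fun n =>
    ⟨0, by rintro _ ⟨z, rfl⟩; exact (hkI n z).2⟩
  let V : ℕ → P → E → ℝ := fun n p e => minimax R L (fun e => k n (π p e)) e
  have hV : ∀ n, ContinuousOn (fun q : P × E => V n q.1 q.2) (univ ×ˢ R) := by
    intro n
    have hkπ : ContinuousOn (fun q : P × E => k n (π q.1 q.2)) (univ ×ˢ R) :=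
      (hkc n).comp_continuousOn hπ
    exact continuousOn_minimax (k := fun p e => k n (π p e)) hRc hR hRL hkπ
  have hVc : ∀ n, Continuous (fun q : P × Z => V n q.1 (co q.2)) := fun n =>
    (hV n).comp_continuous (f := fun q : P × Z => (q.1, co q.2)) (by fun_prop)
      fun q => ⟨mem_univ _, hcoR _⟩
  have hVb : ∀ n p z, V n p (co z) ∈ Icc (-D) 0 := by
    intro n p z
    have h0 : (0 : ℝ) ∈ {r | ∃ C ⊆ R, IsPathConnected C ∧ co z ∈ C ∧ (C ∩ L).Nonempty ∧
        ∀ c ∈ C, k n (π p c) ≤ r} :=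
      ⟨R, subset_rfl, hR.isPathConnected ⟨_, hcoR z⟩, hcoR z, hRL, fun c _ => (hkI _ _).2⟩
    have hlb : ∀ r ∈ {r | ∃ C ⊆ R, IsPathConnected C ∧ co z ∈ C ∧ (C ∩ L).Nonempty ∧
        ∀ c ∈ C, k n (π p c) ≤ r}, -D ≤ r := by
      rintro r ⟨C, -, -, hzC, -, hr⟩
      exact (hkI _ _).1.trans (hr _ hzC)
    exact ⟨le_csInf ⟨0, h0⟩ hlb, csInf_le ⟨-D, hlb⟩ h0⟩
  let f : ℕ → P × Z → ℝ := fun n q => (1 / 2) ^ n * V n q.1 (co q.2)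
  have hfb : ∀ n q, ‖f n q‖ ≤ (1 / 2) ^ n * D := by
    intro n q
    have := hVb n q.1 q.2
    rw [norm_mul, Real.norm_of_nonneg (by positivity), Real.norm_of_nonpos this.2]
    exact mul_le_mul_of_nonneg_left (by linarith [this.1]) (by positivity)
  have hsD : Summable fun n : ℕ => (1 / 2 : ℝ) ^ n * D := summable_geometric_two.mul_right D
  have hsum : ∀ q, Summable fun n => f n q := fun q =>
    Summable.of_norm_bounded hsD fun n => hfb n q
  refine ⟨fun p z => ∑' n, f n (p, z), ?_, fun p => ?_⟩
  · exact continuous_tsum (fun n => (hVc n).const_mul _ ) hsD hfb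
  choose! l hl hlw hfirst hmin using fun w (hw : w ∈ K p) =>
    exists_first_hitting (hγ p) (hγK p) (hirr p) hw
  have hsV : ∀ w ∈ K p, ∀ n, V n p (co w) = sSup (k n '' (γ p '' Icc 0 (l w))) := by
    intro w hw n
    have := minimax_eq_sSup hco hcoR (hπ.comp (f := fun e => (p, e)) (by fun_prop)
      fun e he => ⟨mem_univ _, he⟩) (hπK p) (hπco p) (hπL p) (hL p) (hγ p) (hγK p) (hl w hw)
      (by rw [hlw w hw]; exact hmin w hw) (hkb n)
    rwa [hlw w hw] at this
  have hmono : ∀ w ∈ K p, ∀ w' ∈ K p, l w ≤ l w' → ∀ n, f n (p, w) ≤ f n (p, w') := by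
    intro w hw w' hw' hle n
    refine mul_le_mul_of_nonneg_left ?_ (by positivity)
    change V n p (co w) ≤ V n p (co w')
    rw [hsV w hw, hsV w' hw']
    exact csSup_le_csSup ((hkb n).mono (image_subset_range _ _))
      ⟨_, mem_image_of_mem _ (mem_image_of_mem _ (left_mem_Icc.2 (hl w hw).1))⟩
      (image_mono (image_mono (Icc_subset_Icc le_rfl hle)))
  have hstrict : ∀ w ∈ K p, ∀ w' ∈ K p, l w < l w' →
      ∑' n, f n (p, w) < ∑' n, f n (p, w') := by
    intro w hw w' hw' hlt
    have hcomp : IsCompact (γ p '' Icc 0 (l w)) :=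
      isCompact_Icc.image_of_continuousOn ((hγ p).mono (Icc_subset_Icc le_rfl (hl w hw).2))
    have hne : (γ p '' Icc 0 (l w)).Nonempty := ⟨_, mem_image_of_mem _ (left_mem_Icc.2 (hl w hw).1)⟩
    have hnot : w' ∉ γ p '' Icc 0 (l w) := by
      rintro ⟨x, hx, hxw⟩
      exact hfirst w' hw' x ⟨hx.1, hx.2.trans_lt hlt⟩ hxw
    obtain ⟨n, r, hCr, hr⟩ := hksep _ hcomp hne w' hnot
    refine Summable.tsum_lt_tsum (hmono w hw w' hw' hlt.le) (i := n) ?_ (hsum _) (hsum _)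
    refine mul_lt_mul_of_pos_left ?_ (by positivity)
    change V n p (co w) < V n p (co w')
    rw [hsV w hw, hsV w' hw']
    have e1 : sSup (k n '' (γ p '' Icc 0 (l w))) ≤ r := by
      refine csSup_le (hne.image _) ?_
      rintro _ ⟨z, hz, rfl⟩
      exact hCr z hz
    have e2 : k n w' ≤ sSup (k n '' (γ p '' Icc 0 (l w'))) :=
      le_csSup ((hkb n).mono (image_subset_range _ _)) (mem_image_of_mem _
        ⟨l w', right_mem_Icc.2 (hl w' hw').1, hlw w' hw'⟩)
    linarith
  have h0K := hγK p 0 (by simp)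
  have h1K := hγK p 1 (by simp)
  have hl0 : l (γ p 0) = 0 := by
    by_contra h
    exact hfirst _ h0K 0 ⟨le_rfl, lt_of_le_of_ne (hl _ h0K).1 (Ne.symm h)⟩ rfl
  refine ⟨fun w hw w' hw' h => ?_, fun w hw => ⟨?_, ?_⟩⟩
  · rcases lt_trichotomy (l w) (l w') with h' | h' | h'
    · exact absurd h (hstrict w hw w' hw' h').ne
    · rw [← hlw w hw, ← hlw w' hw', h']
    · exact absurd h (hstrict w' hw' w hw h').ne'
  · exact Summable.tsum_le_tsum (hmono _ h0K w hw (hl0.le.trans (hl w hw).1)) (hsum _) (hsum _)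
  · refine Summable.tsum_le_tsum (hmono w hw _ h1K ?_) (hsum _) (hsum _)
    have hl1 := hl _ h1K
    obtain ⟨x, hx, hxw⟩ := hirr p (γ p '' Icc 0 (l (γ p 1))) (by
        rintro _ ⟨t, ht, rfl⟩
        exact hγK p t ⟨ht.1, ht.2.trans hl1.2⟩)
      (((convex_Icc 0 _).isPathConnected ⟨0, by simp [hl1.1]⟩).image'
        ((hγ p).mono (Icc_subset_Icc le_rfl hl1.2))) ⟨0, by simp [hl1.1], rfl⟩
      ⟨_, right_mem_Icc.2 hl1.1, hlw _ h1K⟩ hw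
    by_contra hlt
    exact hfirst w hw x ⟨hx.1, hx.2.trans_lt (not_le.1 hlt)⟩ hxw

/-- A closed family of irreducible path images `K p` admits a continuous family of injective
parametrizations. -/
theorem exists_uniform_parametrization {P Z : Type*} [TopologicalSpace P] [CompactSpace P]
    [T2Space P] [TopologicalSpace Z] [CompactSpace Z] {K : P → Set Z}
    (hK : IsClosed {q : P × Z | q.2 ∈ K q.1}) {γ : P → ℝ → Z} (hγ0 : Continuous fun p => γ p 0)
    (hγ1 : Continuous fun p => γ p 1) (hγ : ∀ p, ContinuousOn (γ p) (Icc 0 1))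
    (hγK : ∀ p, ∀ x ∈ Icc (0:ℝ) 1, γ p x ∈ K p) (hne : ∀ p, γ p 0 ≠ γ p 1) {u : P → Z → ℝ}
    (hu : Continuous fun q : P × Z => u q.1 q.2) (hinj : ∀ p, InjOn (u p) (K p))
    (hmm : ∀ p, ∀ w ∈ K p, u p (γ p 0) ≤ u p w ∧ u p w ≤ u p (γ p 1)) :
    ∃ ε : P → unitInterval → Z, Continuous (fun q : P × unitInterval => ε q.1 q.2) ∧
      (∀ p, ε p 0 = γ p 0) ∧ (∀ p, ε p 1 = γ p 1) ∧ (∀ p, Function.Injective (ε p)) ∧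
      ∀ p, range (ε p) = K p := by
  have h0K := fun p => hγK p 0 (by simp)
  have h1K := fun p => hγK p 1 (by simp)
  have hpos : ∀ p, 0 < u p (γ p 1) - u p (γ p 0) := fun p =>
    sub_pos.2 (lt_of_le_of_ne (hmm p _ (h1K p)).1 fun h => hne p (hinj p (h0K p) (h1K p) h))
  let Y := {q : P × Z // q.2 ∈ K q.1}
  have : CompactSpace Y := isCompact_iff_compactSpace.1 hK.isCompact
  let v : P → Z → ℝ := fun p w => (u p w - u p (γ p 0)) / (u p (γ p 1) - u p (γ p 0))
  have hv : ∀ q : Y, v q.1.1 q.1.2 ∈ Icc (0:ℝ) 1 := fun q =>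
    ⟨div_nonneg (sub_nonneg.2 (hmm _ _ q.2).1) (hpos _).le,
      (div_le_one (hpos _)).2 (sub_le_sub_right (hmm _ _ q.2).2 _)⟩
  let F : Y → P × unitInterval := fun q => (q.1.1, ⟨v q.1.1 q.1.2, hv q⟩)
  have hvc : Continuous fun q : P × Z => v q.1 q.2 := by
    have c0 : Continuous fun q : P × Z => u q.1 (γ q.1 0) :=
      hu.comp (f := fun q : P × Z => (q.1, γ q.1 0)) (by fun_prop)
    have c1 : Continuous fun q : P × Z => u q.1 (γ q.1 1) :=
      hu.comp (f := fun q : P × Z => (q.1, γ q.1 1)) (by fun_prop)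
    exact (hu.sub c0).div (c1.sub c0) fun q => (hpos _).ne'
  have hFc : Continuous F := by
    refine (continuous_fst.comp continuous_subtype_val).prodMk (Continuous.subtype_mk ?_ _)
    exact hvc.comp continuous_subtype_val
  have hv0 : ∀ p, v p (γ p 0) = 0 := fun p => by simp [v]
  have hv1 : ∀ p, v p (γ p 1) = 1 := fun p => div_self (hpos p).ne'
  have hFinj : Function.Injective F := by
    rintro ⟨⟨p, w⟩, hw⟩ ⟨⟨p', w'⟩, hw'⟩ h
    obtain rfl : p = p' := congrArg Prod.fst h
    have : v p w = v p w' := congrArg (fun q => (q.2 : ℝ)) h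
    simp only [v, div_left_inj' (hpos p).ne', sub_left_inj] at this
    obtain rfl := hinj p hw hw' this
    rfl
  have hFsurj : Function.Surjective F := by
    rintro ⟨p, x⟩
    have hc : ContinuousOn (fun t => v p (γ p t)) (Icc 0 1) :=
      hvc.comp_continuousOn (f := fun t => (p, γ p t)) (continuousOn_const.prodMk (hγ p))
    obtain ⟨t, ht, htx⟩ := intermediate_value_Icc zero_le_one hc (by
      rw [hv0, hv1]; exact x.2 : (x : ℝ) ∈ _)
    exact ⟨⟨(p, γ p t), hγK p t ht⟩, Prod.ext rfl (Subtype.ext htx)⟩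
  let e : Y ≃ₜ P × unitInterval :=
    Continuous.homeoOfEquivCompactToT2 (f := Equiv.ofBijective F ⟨hFinj, hFsurj⟩) hFc
  have he : ∀ q, e q = F q := fun q => rfl
  have hfst : ∀ p x, (e.symm (p, x)).1.1 = p := fun p x => by
    conv_rhs => rw [show p = (e (e.symm (p, x))).1 by rw [e.apply_symm_apply], he]
  have hval : ∀ p, ∀ w (hw : w ∈ K p) (x : unitInterval), v p w = x → (e.symm (p, x)).1.2 = w := by
    intro p w hw x hx
    rw [show (p, x) = e ⟨(p, w), hw⟩ from Prod.ext rfl (Subtype.ext hx.symm), e.symm_apply_apply]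
  refine ⟨fun p x => (e.symm (p, x)).1.2,
    continuous_snd.comp (continuous_subtype_val.comp e.symm.continuous), fun p => hval p _ (h0K p) 0 (hv0 p),
    fun p => hval p _ (h1K p) 1 (hv1 p), fun p x x' h => ?_, fun p => ?_⟩
  · have : e.symm (p, x) = e.symm (p, x') :=
      Subtype.ext (Prod.ext ((hfst p x).trans (hfst p x').symm) h)
    exact congrArg Prod.snd (e.symm.injective this)
  · refine Subset.antisymm ?_ fun w hw => ⟨⟨v p w, hv ⟨(p, w), hw⟩⟩, hval p w hw _ rfl⟩
    rintro _ ⟨x, rfl⟩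
    have := (e.symm (p, x)).2
    rwa [hfst] at this

end Parametrization

/-- Two suspension structures on `X`, one of them over a join, with the same poles. -/
structure IsDoubleSusp {C₁ C₂ X Z : Type*} [TopologicalSpace C₁] [TopologicalSpace C₂]
    [TopologicalSpace X] [TopologicalSpace Z] (Q : C₁ → C₂ → ℝ → ℝ → X) (α : X → C₁) (β : X → C₂)
    (ξ σ : X → ℝ) (S : Z → ℝ → X) (ζ : X → Z) (τ : X → ℝ) : Prop where
  join : IsJoinSusp Q α β ξ σ
  susp : IsSusp S ζ τ
  bot : ∀ z, σ (S z 0) = 0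
  top : ∀ z, σ (S z 1) = 1

namespace IsDoubleSusp

variable {C₁ C₂ X Z : Type*} [TopologicalSpace C₁] [TopologicalSpace C₂]
    [TopologicalSpace X] [TopologicalSpace Z] {Q : C₁ → C₂ → ℝ → ℝ → X} {α : X → C₁} {β : X → C₂}
    {ξ σ : X → ℝ} {S : Z → ℝ → X} {ζ : X → Z} {τ : X → ℝ}

theorem swap (h : IsDoubleSusp Q α β ξ σ S ζ τ) :
    IsDoubleSusp (fun b a x s => Q a b (1 - x) s) β α (fun m => 1 - ξ m) σ S ζ τ :=
  ⟨h.join.swap, h.susp, h.bot, h.top⟩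

theorem σ_line (h : IsDoubleSusp Q α β ξ σ S ζ τ) (z : Z) {s : ℝ} (hs : s ∈ Ioo (0 : ℝ) 1) :
    σ (S z s) ∈ Ioo 0 1 :=
  h.join.σ_line_mem_Ioo h.susp h.bot h.top z hs

theorem τ_mem (h : IsDoubleSusp Q α β ξ σ S ζ τ) {m : X} (hm : σ m ∈ Ioo 0 1) : τ m ∈ Ioo 0 1 :=
  h.susp.τ_mem_Ioo h.bot h.top hm

theorem continuous_line (h : IsDoubleSusp Q α β ξ σ S ζ τ) (z : Z) : Continuous (S z) :=
  h.susp.cont.comp (g := fun p : Z × ℝ => S p.1 p.2) (f := fun t => (z, t)) (by fun_prop)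

theorem continuousOn_ξ_line (h : IsDoubleSusp Q α β ξ σ S ζ τ) (z : Z) :
    ContinuousOn (fun s => ξ (S z s)) (Ioo 0 1) :=
  h.join.cont_ξ.comp (h.continuous_line z).continuousOn fun _ hs => h.σ_line z hs

theorem ξ_line (h : IsDoubleSusp Q α β ξ σ S ζ τ) [TotallyDisconnectedSpace C₁]
    [TotallyDisconnectedSpace C₂] [Infinite C₁] [Infinite C₂] (z : Z) :
    (∀ s ∈ Ioo (0:ℝ) 1, ξ (S z s) ∈ Ioo 0 1) ∨ (∀ s ∈ Ioo (0:ℝ) 1, ξ (S z s) = 0) ∨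
      ∀ s ∈ Ioo (0:ℝ) 1, ξ (S z s) = 1 := by
  have n0 : ∀ s ∈ Ioo (0:ℝ) 1, ∀ s' ∈ Ioo (0:ℝ) 1, ξ (S z s) = 0 → ξ (S z s') ∉ Ioo 0 1 :=
    fun s hs s' hs' e => h.join.ξ_line_not_mem_Ioo h.susp h.bot h.top z hs hs' e
  have n1 : ∀ s ∈ Ioo (0:ℝ) 1, ∀ s' ∈ Ioo (0:ℝ) 1, ξ (S z s) = 1 → ξ (S z s') ∉ Ioo 0 1 := by
    intro s hs s' hs' e e'
    exact h.join.swap.ξ_line_not_mem_Ioo h.susp h.bot h.top z hs hs' (by linarith)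
      ⟨by linarith [e'.2], by linarith [e'.1]⟩
  have hoc := (isPreconnected_Ioo.image _ (h.continuousOn_ξ_line z)).ordConnected
  have hcases : ∀ s, ξ (S z s) = 0 ∨ ξ (S z s) = 1 ∨ ξ (S z s) ∈ Ioo 0 1 := fun s => by
    have := h.join.ξ_mem (S z s)
    rcases this.1.eq_or_lt with e | e
    · exact Or.inl e.symm
    · rcases this.2.eq_or_lt with e' | e'
      · exact Or.inr (Or.inl e')
      · exact Or.inr (Or.inr ⟨e, e'⟩)
  have n01 : ∀ s ∈ Ioo (0:ℝ) 1, ∀ s' ∈ Ioo (0:ℝ) 1, ξ (S z s) = 0 → ξ (S z s') ≠ 1 := by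
    intro s hs s' hs' e e'
    obtain ⟨s'', hs'', e''⟩ := hoc.out ⟨s, hs, e⟩ ⟨s', hs', e'⟩
      (show (1 / 2 : ℝ) ∈ Icc 0 1 by norm_num)
    simp only at e''
    exact n0 s hs s'' hs'' e (by rw [e'']; norm_num)
  by_cases c0 : ∃ s ∈ Ioo (0:ℝ) 1, ξ (S z s) = 0
  · obtain ⟨s, hs, e⟩ := c0
    exact Or.inr (Or.inl fun s' hs' => (hcases s').resolve_right fun e' =>
      e'.elim (n01 s hs s' hs' e) (n0 s hs s' hs' e))
  · by_cases c1 : ∃ s ∈ Ioo (0:ℝ) 1, ξ (S z s) = 1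
    · obtain ⟨s, hs, e⟩ := c1
      exact Or.inr (Or.inr fun s' hs' => ((hcases s').resolve_left fun e' => c0 ⟨s', hs', e'⟩
        ).resolve_right (n1 s hs s' hs' e))
    · exact Or.inl fun s hs => ((hcases s).resolve_left fun e => c0 ⟨s, hs, e⟩).resolve_left
        fun e => c1 ⟨s, hs, e⟩

theorem α_line (h : IsDoubleSusp Q α β ξ σ S ζ τ) [TotallyDisconnectedSpace C₁] {z : Z}
    (hz : ∀ s ∈ Ioo (0:ℝ) 1, ξ (S z s) < 1) {s s' : ℝ} (hs : s ∈ Ioo (0:ℝ) 1)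
    (hs' : s' ∈ Ioo (0:ℝ) 1) : α (S z s) = α (S z s') :=
  (isPreconnected_Ioo.image (fun s => α (S z s)) (h.join.cont_α.comp
    (h.continuous_line z).continuousOn fun s hs => ⟨h.σ_line z hs, hz s hs⟩)).subsingleton
    (mem_image_of_mem _ hs) (mem_image_of_mem _ hs')

theorem mk_eq_iff (h : IsDoubleSusp Q α β ξ σ S ζ τ) {a : C₁} {b : C₂} {m : X}
    (hm : σ m ∈ Ioo 0 1) : Q a b (ξ m) (σ m) = m ↔ (ξ m = 1 ∨ α m = a) ∧ (ξ m = 0 ∨ β m = b) := by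
  conv_lhs => rhs; rw [← h.join.mk_coord m]
  rw [eq_comm, h.join.eq_iff _ _ _ _ _ (h.join.ξ_mem m) _ (h.join.ξ_mem m) _ (h.join.σ_mem m) _
    (h.join.σ_mem m)]
  simp [hm.1.ne', hm.2.ne]

variable [TotallyDisconnectedSpace C₁] [TotallyDisconnectedSpace C₂] [Infinite C₁] [Infinite C₂]

/-- The sheet over a pair `(a, b)` is a union of suspension lines. -/
theorem sheet_line (h : IsDoubleSusp Q α β ξ σ S ζ τ) {a : C₁} {b : C₂} {z : Z} {s s' : ℝ}
    (hs : s ∈ Ioo (0:ℝ) 1) (hs' : s' ∈ Ioo (0:ℝ) 1)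
    (hm : Q a b (ξ (S z s)) (σ (S z s)) = S z s) :
    Q a b (ξ (S z s')) (σ (S z s')) = S z s' := by
  rw [h.mk_eq_iff (h.σ_line z hs)] at hm
  rw [h.mk_eq_iff (h.σ_line z hs')]
  have hα : (∀ s ∈ Ioo (0:ℝ) 1, ξ (S z s) < 1) → α (S z s) = α (S z s') := fun hz =>
    h.α_line hz hs hs'
  have hβ : (∀ s ∈ Ioo (0:ℝ) 1, 0 < ξ (S z s)) → β (S z s) = β (S z s') := fun hz =>
    h.swap.α_line (fun s hs => by linarith [hz s hs]) hs hs'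
  rcases h.ξ_line z with hz | hz | hz
  · rw [← hα fun s hs => (hz s hs).2, ← hβ fun s hs => (hz s hs).1]
    exact ⟨Or.inr (hm.1.resolve_left (hz s hs).2.ne), Or.inr (hm.2.resolve_left (hz s hs).1.ne')⟩
  · rw [← hα fun s hs => by rw [hz s hs]; exact one_pos]
    exact ⟨Or.inr (hm.1.resolve_left (by rw [hz s hs]; exact zero_ne_one)), Or.inl (hz s' hs')⟩
  · rw [← hβ fun s hs => by rw [hz s hs]; exact one_pos]
    exact ⟨Or.inl (hz s' hs'), Or.inr (hm.2.resolve_left (by rw [hz s hs]; exact one_ne_zero))⟩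

/-- Each arc of the binding `ξ = 0` is a single suspension line. -/
theorem eq_of_binding (h : IsDoubleSusp Q α β ξ σ S ζ τ) {z z' : Z} {s s' : ℝ}
    (hs : s ∈ Ioo (0:ℝ) 1) (hs' : s' ∈ Ioo (0:ℝ) 1) (e : ξ (S z s) = 0) (e' : ξ (S z' s') = 0)
    (hα : α (S z s) = α (S z' s')) : z = z' := by
  have key : ∀ z : Z, ∀ s ∈ Ioo (0:ℝ) 1, ξ (S z s) = 0 → ∀ t ∈ Ioo (0:ℝ) 1,
      ξ (S z t) = 0 ∧ α (S z t) = α (S z s) := by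
    intro z s hs e t ht
    have hz : ∀ s ∈ Ioo (0:ℝ) 1, ξ (S z s) = 0 := by
      rcases h.ξ_line z with hz | hz | hz
      · exact absurd e (hz s hs).1.ne'
      · exact hz
      · rw [hz s hs] at e
        exact absurd e one_ne_zero
    exact ⟨hz t ht, h.α_line (fun s hs => by rw [hz s hs]; exact one_pos) ht hs⟩
  have hs'σ := h.σ_line z' hs'
  obtain ⟨t, ht, hte⟩ := intermediate_value_Icc zero_le_one
    (h.join.cont_σ.comp (h.continuous_line z)).continuousOn (by
      simp only [Function.comp, h.bot, h.top]
      exact Ioo_subset_Icc_self hs'σ : σ (S z' s') ∈ _)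
  simp only [Function.comp] at hte
  have ht' : t ∈ Ioo (0:ℝ) 1 := by
    refine ⟨ht.1.lt_of_ne fun e => ?_, ht.2.lt_of_ne fun e => ?_⟩
    · rw [← e, h.bot] at hte
      exact hs'σ.1.ne hte
    · rw [e, h.top] at hte
      exact hs'σ.2.ne' hte
  obtain ⟨k1, k2⟩ := key z s hs e t ht'
  have : S z t = S z' s' := by
    rw [← h.join.mk_coord (S z t), ← h.join.mk_coord (S z' s'), k1, e', k2, hα, hte]
    exact (h.join.eq_iff _ _ _ _ 0 (by simp) 0 (by simp) _ (h.join.σ_mem _) _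
      (h.join.σ_mem _)).2 ⟨rfl, Or.inr (Or.inr ⟨rfl, Or.inr rfl, Or.inl rfl⟩)⟩
  rw [← h.susp.ζ_mk z ht', this, h.susp.ζ_mk z' hs']

/-- The trace of the sheet over `(a, b)` on the middle level of the suspension of `Z`. -/
theorem ζ_mem_sheet (h : IsDoubleSusp Q α β ξ σ S ζ τ) (a : C₁) (b : C₂) {x s : ℝ}
    (hx : x ∈ Icc (0:ℝ) 1) (hs : s ∈ Ioo (0:ℝ) 1) :
    Q a b (ξ (S (ζ (Q a b x s)) (1 / 2))) (σ (S (ζ (Q a b x s)) (1 / 2))) =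
      S (ζ (Q a b x s)) (1 / 2) := by
  have hσ := h.join.σ_mk a b hx (Ioo_subset_Icc_self hs)
  refine h.sheet_line (s := τ (Q a b x s)) (h.τ_mem (by rwa [hσ])) (by norm_num) ?_
  rw [h.susp.mk_coord, hσ, h.join.ξ_mk a b hx hs]

theorem ζ_eq_of_binding (h : IsDoubleSusp Q α β ξ σ S ζ τ) (a : C₁) (b b' : C₂) {s s' : ℝ}
    (hs : s ∈ Ioo (0:ℝ) 1) (hs' : s' ∈ Ioo (0:ℝ) 1) : ζ (Q a b 0 s) = ζ (Q a b' 0 s') := by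
  have h0 : (0:ℝ) ∈ Icc (0:ℝ) 1 := by simp
  have hσ := h.join.σ_mk a b h0 (Ioo_subset_Icc_self hs)
  have hσ' := h.join.σ_mk a b' h0 (Ioo_subset_Icc_self hs')
  refine h.eq_of_binding (s := τ (Q a b 0 s)) (s' := τ (Q a b' 0 s')) (h.τ_mem (by rwa [hσ]))
    (h.τ_mem (by rwa [hσ'])) ?_ ?_ ?_ <;> simp only [h.susp.mk_coord]
  · exact h.join.ξ_mk a b h0 hs
  · exact h.join.ξ_mk a b' h0 hs'
  · rw [h.join.α_mk a b (by simp) hs, h.join.α_mk a b' (by simp) hs']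

theorem ξ_ζ_zero (h : IsDoubleSusp Q α β ξ σ S ζ τ) (a : C₁) (b : C₂) {s t : ℝ}
    (hs : s ∈ Ioo (0:ℝ) 1) (ht : t ∈ Ioo (0:ℝ) 1) : ξ (S (ζ (Q a b 0 s)) t) = 0 := by
  have h0 : (0:ℝ) ∈ Icc (0:ℝ) 1 := by simp
  have hσ := h.join.σ_mk a b h0 (Ioo_subset_Icc_self hs)
  have hτ := h.τ_mem (m := Q a b 0 s) (by rwa [hσ])
  have e : ξ (S (ζ (Q a b 0 s)) (τ (Q a b 0 s))) = 0 := by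
    rw [h.susp.mk_coord, h.join.ξ_mk a b h0 hs]
  rcases h.ξ_line (ζ (Q a b 0 s)) with hz | hz | hz
  · exact absurd e (hz _ hτ).1.ne'
  · exact hz t ht
  · rw [hz _ hτ] at e
    exact absurd e one_ne_zero

theorem ξ_ζ_one (h : IsDoubleSusp Q α β ξ σ S ζ τ) (a : C₁) (b : C₂) {s t : ℝ}
    (hs : s ∈ Ioo (0:ℝ) 1) (ht : t ∈ Ioo (0:ℝ) 1) : ξ (S (ζ (Q a b 1 s)) t) = 1 := by
  have := h.swap.ξ_ζ_zero b a hs ht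
  rw [sub_zero] at this
  linarith

end IsDoubleSusp

namespace IsDoubleSusp

variable {C₁ C₂ X Z : Type*} [TopologicalSpace C₁] [TopologicalSpace C₂]
    [TopologicalSpace X] [TopologicalSpace Z] {Q : C₁ → C₂ → ℝ → ℝ → X} {α : X → C₁} {β : X → C₂}
    {ξ σ : X → ℝ} {S : Z → ℝ → X} {ζ : X → Z} {τ : X → ℝ}

theorem continuous_mid (h : IsDoubleSusp Q α β ξ σ S ζ τ) : Continuous fun z => S z (1 / 2) :=
  h.susp.cont.comp (g := fun p : Z × ℝ => S p.1 p.2) (f := fun z => (z, 1 / 2)) (by fun_prop)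

theorem σ_mid (h : IsDoubleSusp Q α β ξ σ S ζ τ) (z : Z) : σ (S z (1 / 2)) ∈ Ioo 0 1 :=
  h.σ_line z (by norm_num)

theorem continuous_ξ_mid (h : IsDoubleSusp Q α β ξ σ S ζ τ) :
    Continuous fun z => ξ (S z (1 / 2)) :=
  h.join.cont_ξ.comp_continuous h.continuous_mid h.σ_mid

theorem exists_σ_line_eq (h : IsDoubleSusp Q α β ξ σ S ζ τ) (z : Z) {r : ℝ}
    (hr : r ∈ Ioo (0:ℝ) 1) : ∃ s ∈ Ioo (0:ℝ) 1, σ (S z s) = r := by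
  obtain ⟨t, ht, hte⟩ := intermediate_value_Icc zero_le_one
    (h.join.cont_σ.comp (h.continuous_line z)).continuousOn (by
      simp only [Function.comp, h.bot, h.top]
      exact Ioo_subset_Icc_self hr : r ∈ _)
  simp only [Function.comp] at hte
  refine ⟨t, ⟨ht.1.lt_of_ne fun e => ?_, ht.2.lt_of_ne fun e => ?_⟩, hte⟩
  · rw [← e, h.bot] at hte
    exact hr.1.ne hte
  · rw [e, h.top] at hte
    exact hr.2.ne' hte

/-- Continuity of `ζ` in all four coordinates. -/
theorem continuousOn_ζ_mk (h : IsDoubleSusp Q α β ξ σ S ζ τ) :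
    ContinuousOn (fun q : (C₁ × C₂) × ℝ × ℝ => ζ (Q q.1.1 q.1.2 q.2.1 q.2.2))
      (univ ×ˢ (Icc 0 1 ×ˢ Ioo 0 1)) := by
  refine h.susp.cont_ζ.comp (Continuous.continuousOn (h.join.cont.comp
    (g := fun p : C₁ × C₂ × ℝ × ℝ => Q p.1 p.2.1 p.2.2.1 p.2.2.2)
    (f := fun q : (C₁ × C₂) × ℝ × ℝ => (q.1.1, q.1.2, q.2.1, q.2.2)) (by fun_prop))) ?_
  rintro ⟨⟨a, b⟩, x, s⟩ ⟨-, hx, hs⟩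
  refine h.τ_mem ?_
  simp only at hx hs ⊢
  rwa [h.join.σ_mk a b hx (Ioo_subset_Icc_self hs)]

variable [TotallyDisconnectedSpace C₁] [TotallyDisconnectedSpace C₂] [Infinite C₁] [Infinite C₂]

/-- A path connected subset of the sheet over `(a, b)` joining the two bindings crosses every
suspension line of the sheet. -/
theorem mem_of_isPathConnected (h : IsDoubleSusp Q α β ξ σ S ζ τ) {a : C₁} {b : C₂} {C : Set Z}
    (hC : IsPathConnected C)
    (hCK : ∀ w ∈ C, Q a b (ξ (S w (1 / 2))) (σ (S w (1 / 2))) = S w (1 / 2))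
    (h0 : ζ (Q a b 0 (1 / 2)) ∈ C) (h1 : ζ (Q a b 1 (1 / 2)) ∈ C) {z : Z}
    (hz : Q a b (ξ (S z (1 / 2))) (σ (S z (1 / 2))) = S z (1 / 2)) : z ∈ C := by
  obtain ⟨p, hp⟩ := hC.joinedIn _ h0 _ h1
  have hpC : ∀ t, p.extend t ∈ C := fun t => hp _
  have hcσ : Continuous fun t => σ (S (p.extend t) (1 / 2)) :=
    h.join.cont_σ.comp (h.continuous_mid.comp p.continuous_extend)
  have hcξ : Continuous fun t => ξ (S (p.extend t) (1 / 2)) :=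
    h.continuous_ξ_mid.comp p.continuous_extend
  obtain ⟨t₀, -, ht₀⟩ := (isCompact_Icc (a := (0:ℝ)) (b := 1)).exists_isMinOn ⟨0, by simp⟩
    hcσ.continuousOn
  obtain ⟨t₁, -, ht₁⟩ := (isCompact_Icc (a := (0:ℝ)) (b := 1)).exists_isMaxOn ⟨0, by simp⟩
    hcσ.continuousOn
  obtain ⟨s₀, hs₀, e₀⟩ := h.exists_σ_line_eq z (h.σ_mid (p.extend t₀))
  obtain ⟨s₁, hs₁, e₁⟩ := h.exists_σ_line_eq z (h.σ_mid (p.extend t₁))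
  have hm : ∀ t ∈ Icc (0:ℝ) 1, s₀ + t * (s₁ - s₀) ∈ Ioo (0:ℝ) 1 := by
    intro t ht
    have := (convex_Ioo (0:ℝ) 1) hs₀ hs₁ (sub_nonneg.2 ht.2) ht.1 (by ring)
    simpa only [smul_eq_mul, show (1 - t) * s₀ + t * s₁ = s₀ + t * (s₁ - s₀) by ring] using this
  have hlσ : ContinuousOn (fun t => σ (S z (s₀ + t * (s₁ - s₀)))) (Icc 0 1) :=
    (h.join.cont_σ.comp ((h.continuous_line z).comp (by fun_prop))).continuousOn
  have hlξ : ContinuousOn (fun t => ξ (S z (s₀ + t * (s₁ - s₀)))) (Icc 0 1) :=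
    (h.continuousOn_ξ_line z).comp (by fun_prop) hm
  have hmk : ∀ u v : ℝ, (u : ℂ) + (v : ℂ) * Complex.I = ⟨u, v⟩ := fun u v => by
    simp [Complex.ext_iff]
  have key : ∀ u v : ℝ → ℝ, ContinuousOn u (Icc 0 1) → ContinuousOn v (Icc 0 1) →
      ContinuousOn (fun t => (⟨u t, v t⟩ : ℂ)) (Icc 0 1) := by
    intro u v hu hv
    simp only [← hmk]
    exact (Complex.continuous_ofReal.comp_continuousOn hu).add
        ((Complex.continuous_ofReal.comp_continuousOn hv).mul continuousOn_const)
  obtain ⟨s, hs, t, ht, hst⟩ := paths_meet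
    (fun t => ⟨ξ (S (p.extend t) (1 / 2)), σ (S (p.extend t) (1 / 2))⟩)
    (fun t => ⟨ξ (S z (s₀ + t * (s₁ - s₀))), σ (S z (s₀ + t * (s₁ - s₀)))⟩)
    (key _ _ hcξ.continuousOn hcσ.continuousOn) (key _ _ hlξ hlσ)
    (fun t ht => by
      simp only [p.extend_zero, h.ξ_ζ_zero a b (s := 1 / 2) (t := 1 / 2) (by norm_num)
        (by norm_num)]
      exact (h.join.ξ_mem _).1)
    (fun t ht => by
      simp only [p.extend_one, h.ξ_ζ_one a b (s := 1 / 2) (t := 1 / 2) (by norm_num)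
        (by norm_num)]
      exact (h.join.ξ_mem _).2)
    (fun t ht => by
      simp only [zero_mul, add_zero, e₀]
      exact ht₀ ht)
    (fun t ht => by
      simp only [one_mul, add_sub_cancel, e₁]
      exact ht₁ ht)
  have hξ : ξ (S (p.extend s) (1 / 2)) = ξ (S z (s₀ + t * (s₁ - s₀))) := congrArg Complex.re hst
  have hσ : σ (S (p.extend s) (1 / 2)) = σ (S z (s₀ + t * (s₁ - s₀))) := congrArg Complex.im hst
  have e : S (p.extend s) (1 / 2) = S z (s₀ + t * (s₁ - s₀)) := by
    rw [← hCK _ (hpC s), hξ, hσ, h.sheet_line (by norm_num) (hm t ht) hz]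
  rw [← h.susp.ζ_mk z (hm t ht), ← e, h.susp.ζ_mk _ (by norm_num)]
  exact hpC s

theorem exists_sheet_parametrization [CompactSpace C₁] [CompactSpace C₂] [T2Space C₁] [T2Space C₂]
    [CompactSpace Z] [TopologicalSpace.MetrizableSpace Z] [T2Space X]
    (h : IsDoubleSusp Q α β ξ σ S ζ τ) :
    ∃ E : C₁ → C₂ → unitInterval → Z,
      Continuous (fun q : C₁ × C₂ × unitInterval => E q.1 q.2.1 q.2.2) ∧
      (∀ a b, E a b 0 = ζ (Q a b 0 (1 / 2))) ∧ (∀ a b, E a b 1 = ζ (Q a b 1 (1 / 2))) ∧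
      (∀ a b, Function.Injective (E a b)) ∧ ∀ a b z, z ∈ range (E a b) ↔
        Q a b (ξ (S z (1 / 2))) (σ (S z (1 / 2))) = S z (1 / 2) := by
  have : Nonempty Z := ⟨ζ (Q (Classical.arbitrary C₁) (Classical.arbitrary C₂) 0 0)⟩
  have hcσ : Continuous fun z => σ (S z (1 / 2)) := h.join.cont_σ.comp h.continuous_mid
  obtain ⟨z₀, -, hz₀⟩ := isCompact_univ.exists_isMinOn univ_nonempty hcσ.continuousOn
  obtain ⟨z₁, -, hz₁⟩ := isCompact_univ.exists_isMaxOn univ_nonempty hcσ.continuousOn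
  set m := σ (S z₀ (1 / 2))
  set M := σ (S z₁ (1 / 2))
  have hmM : ∀ z, σ (S z (1 / 2)) ∈ Icc m M := fun z => ⟨hz₀ (mem_univ z), hz₁ (mem_univ z)⟩
  have hI : Icc m M ⊆ Ioo 0 1 := fun s hs =>
    ⟨(h.σ_mid z₀).1.trans_le hs.1, hs.2.trans_lt (h.σ_mid z₁).2⟩
  let R : Set (ℝ × ℝ) := Icc 0 1 ×ˢ Icc m M
  let L : Set (ℝ × ℝ) := {e | e.1 = 0}
  let K : C₁ × C₂ → Set Z := fun p =>
    {z | Q p.1 p.2 (ξ (S z (1 / 2))) (σ (S z (1 / 2))) = S z (1 / 2)}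
  let co : Z → ℝ × ℝ := fun z => (ξ (S z (1 / 2)), σ (S z (1 / 2)))
  let π : C₁ × C₂ → ℝ × ℝ → Z := fun p e => ζ (Q p.1 p.2 e.1 e.2)
  let γ : C₁ × C₂ → ℝ → Z := fun p x => ζ (Q p.1 p.2 x (1 / 2))
  have half : (1 / 2 : ℝ) ∈ Ioo (0:ℝ) 1 := by norm_num
  have hγ : ContinuousOn (fun q : (C₁ × C₂) × ℝ => γ q.1 q.2) (univ ×ˢ Icc 0 1) :=
    h.continuousOn_ζ_mk.comp (f := fun q : (C₁ × C₂) × ℝ => (q.1, q.2, 1 / 2)) (by fun_prop)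
      fun q hq => ⟨mem_univ _, hq.2, half⟩
  have hγx : ∀ x ∈ Icc (0:ℝ) 1, Continuous fun p => γ p x := fun x hx =>
    hγ.comp_continuous (f := fun p => (p, x)) (by fun_prop) fun p => ⟨mem_univ _, hx⟩
  have hγp : ∀ p, ContinuousOn (γ p) (Icc 0 1) := fun p =>
    hγ.comp (f := fun x => (p, x)) (by fun_prop) fun x hx => ⟨mem_univ _, hx⟩
  have hγK : ∀ p, ∀ x ∈ Icc (0:ℝ) 1, γ p x ∈ K p := fun p x hx =>
    h.ζ_mem_sheet p.1 p.2 hx half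
  obtain ⟨u, huc, hu⟩ := exists_monotone_family (R := R) (L := L) (K := K) (co := co) (π := π)
    (γ := γ) (isCompact_Icc.prod isCompact_Icc) ((convex_Icc 0 1).prod (convex_Icc m M))
    ⟨(0, m), ⟨by simp, left_mem_Icc.2 ((hmM z₀).1.trans (hmM z₀).2)⟩, rfl⟩
    (h.continuous_ξ_mid.prodMk hcσ) (fun z => ⟨h.join.ξ_mem _, hmM z⟩)
    (h.continuousOn_ζ_mk.mono (prod_mono subset_rfl (prod_mono subset_rfl hI)))
    (fun p e he => h.ζ_mem_sheet p.1 p.2 he.1 (hI he.2))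
    (fun p w hw => by
      simp only [π, co]
      rw [show Q p.1 p.2 _ _ = _ from hw, h.susp.ζ_mk w half])
    (fun p e he => by
      obtain ⟨⟨x, s⟩, rfl⟩ : ∃ e', e = e' := ⟨e, rfl⟩
      obtain ⟨he, rfl : x = 0⟩ := he
      exact h.ζ_eq_of_binding p.1 p.2 p.2 (hI he.2) half)
    (fun p => h.ξ_ζ_zero p.1 p.2 half half) hγp hγK
    (fun p C hCK hC h0 h1 z hz => h.mem_of_isPathConnected hC hCK h0 h1 hz)
  have hKc : IsClosed {q : (C₁ × C₂) × Z | q.2 ∈ K q.1} := by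
    refine isClosed_eq ?_ (h.continuous_mid.comp continuous_snd)
    exact h.join.cont.comp (g := fun p : C₁ × C₂ × ℝ × ℝ => Q p.1 p.2.1 p.2.2.1 p.2.2.2)
      (f := fun q : (C₁ × C₂) × Z =>
        (q.1.1, q.1.2, ξ (S q.2 (1 / 2)), σ (S q.2 (1 / 2))))
      ((continuous_fst.comp continuous_fst).prodMk ((continuous_snd.comp continuous_fst).prodMk
        ((h.continuous_ξ_mid.comp continuous_snd).prodMk (hcσ.comp continuous_snd))))
  obtain ⟨ε, hε, hε0, hε1, hεi, hεr⟩ := exists_uniform_parametrization hKc (hγx 0 (by simp))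
    (hγx 1 (by simp)) hγp hγK (fun p e => by
      have e0 := h.ξ_ζ_zero p.1 p.2 half half
      have e1 := h.ξ_ζ_one p.1 p.2 half half
      simp only [γ] at e
      rw [e, e1] at e0
      exact one_ne_zero e0) huc (fun p => (hu p).1) (fun p => (hu p).2)
  refine ⟨fun a b => ε (a, b), hε.comp (f := fun q : C₁ × C₂ × unitInterval =>
    ((q.1, q.2.1), q.2.2)) (by fun_prop), fun a b => hε0 _, fun a b => hε1 _, fun a b => hεi _,
    fun a b z => ?_⟩
  rw [hεr]
  rfl

theorem sheet_parametrization_eq_iff (h : IsDoubleSusp Q α β ξ σ S ζ τ)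
    {E : C₁ → C₂ → unitInterval → Z}
    (h0 : ∀ a b, E a b 0 = ζ (Q a b 0 (1 / 2))) (h1 : ∀ a b, E a b 1 = ζ (Q a b 1 (1 / 2)))
    (hi : ∀ a b, Function.Injective (E a b)) (hr : ∀ a b z, z ∈ range (E a b) ↔
        Q a b (ξ (S z (1 / 2))) (σ (S z (1 / 2))) = S z (1 / 2)) :
    (∀ a b x, ξ (S (E a b x) (1 / 2)) = 0 ↔ x = 0) ∧
    (∀ a b x, ξ (S (E a b x) (1 / 2)) = 1 ↔ x = 1) ∧
    ∀ a b x a' b' x', E a b x = E a' b' x' ↔ x = x' ∧ (x = 1 ∨ a = a') ∧ (x = 0 ∨ b = b') := by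
  have half : (1 / 2 : ℝ) ∈ Ioo (0:ℝ) 1 := by norm_num
  have hsh : ∀ a b x, (ξ (S (E a b x) (1 / 2)) = 1 ∨ α (S (E a b x) (1 / 2)) = a) ∧
      (ξ (S (E a b x) (1 / 2)) = 0 ∨ β (S (E a b x) (1 / 2)) = b) := fun a b x =>
    (h.mk_eq_iff (h.σ_mid _)).1 ((hr a b _).1 ⟨x, rfl⟩)
  have i0 : ∀ a b, ξ (S (E a b 0) (1 / 2)) = 0 := fun a b => by
    rw [h0]
    exact h.ξ_ζ_zero a b half half
  have i1 : ∀ a b, ξ (S (E a b 1) (1 / 2)) = 1 := fun a b => by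
    rw [h1]
    exact h.ξ_ζ_one a b half half
  have k0 : ∀ a b x, ξ (S (E a b x) (1 / 2)) = 0 ↔ x = 0 := by
    intro a b x
    refine ⟨fun e => hi a b ?_, fun e => by rw [e, i0]⟩
    refine h.eq_of_binding half half e (i0 a b) ?_
    rw [(hsh a b x).1.resolve_left (by rw [e]; exact zero_ne_one),
      (hsh a b 0).1.resolve_left (by rw [i0]; exact zero_ne_one)]
  have k1 : ∀ a b x, ξ (S (E a b x) (1 / 2)) = 1 ↔ x = 1 := by
    intro a b x
    refine ⟨fun e => hi a b ?_, fun e => by rw [e, i1]⟩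
    refine h.swap.eq_of_binding half half (by linarith) (by linarith [i1 a b]) ?_
    rw [(hsh a b x).2.resolve_left (by rw [e]; exact one_ne_zero),
      (hsh a b 1).2.resolve_left (by rw [i1]; exact one_ne_zero)]
  refine ⟨k0, k1, fun a b x a' b' x' => ⟨fun e => ?_, ?_⟩⟩
  · have hx := hsh a b x
    have hx' := hsh a' b' x'
    rw [← e] at hx'
    by_cases c0 : ξ (S (E a b x) (1 / 2)) = 0
    · have x0 := (k0 a b x).1 c0
      have x0' := (k0 a' b' x').1 (e ▸ c0)
      refine ⟨x0.trans x0'.symm, Or.inr ?_, Or.inl x0⟩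
      rw [c0] at hx hx'
      rw [← hx.1.resolve_left zero_ne_one, ← hx'.1.resolve_left zero_ne_one]
    by_cases c1 : ξ (S (E a b x) (1 / 2)) = 1
    · have x1 := (k1 a b x).1 c1
      have x1' := (k1 a' b' x').1 (e ▸ c1)
      refine ⟨x1.trans x1'.symm, Or.inl x1, Or.inr ?_⟩
      rw [← hx.2.resolve_left c0, ← hx'.2.resolve_left c0]
    · have ea := (hx.1.resolve_left c1).symm.trans (hx'.1.resolve_left c1)
      have eb := (hx.2.resolve_left c0).symm.trans (hx'.2.resolve_left c0)
      subst ea eb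
      exact ⟨hi a b e, Or.inr rfl, Or.inr rfl⟩
  · rintro ⟨rfl, c1, c0⟩
    rcases c1 with rfl | rfl
    · obtain rfl := c0.resolve_left one_ne_zero
      rw [h1, h1]
      have := h.swap.ζ_eq_of_binding b a a' half half
      rwa [sub_zero] at this
    · rcases c0 with rfl | rfl
      · rw [h0, h0]
        exact h.ζ_eq_of_binding a b b' half half
      · rfl

end IsDoubleSusp

theorem continuous_mul_comp_div {P : Type*} [TopologicalSpace P] {Φ : P × ℝ → ℝ}
    (hΦ : Continuous Φ) {B : ℝ} (hB : ∀ q, |Φ q| ≤ B) :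
    Continuous fun q : P × ℝ × ℝ => q.2.2 * Φ (q.1, q.2.1 / q.2.2) := by
  rw [continuous_iff_continuousAt]
  rintro ⟨p, u, r⟩
  rcases eq_or_ne r 0 with rfl | hr
  · have h0 : Tendsto (fun q : P × ℝ × ℝ => |q.2.2| * B) (𝓝 (p, u, 0)) (𝓝 0) := by
      have : Continuous fun q : P × ℝ × ℝ => |q.2.2| * B := by fun_prop
      simpa using this.tendsto (p, u, 0)
    have h1 : Tendsto (fun q : P × ℝ × ℝ => q.2.2 * Φ (q.1, q.2.1 / q.2.2)) (𝓝 (p, u, 0))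
        (𝓝 0) := by
      refine squeeze_zero_norm (fun q => ?_) h0
      rw [Real.norm_eq_abs, abs_mul]
      exact mul_le_mul_of_nonneg_left (hB _) (abs_nonneg _)
    simpa [ContinuousAt] using h1
  · have h2 : ContinuousAt (fun q : P × ℝ × ℝ => q.2.1 / q.2.2) (p, u, r) :=
      ContinuousAt.div (by fun_prop) (by fun_prop) hr
    have h3 : ContinuousAt (fun q : P × ℝ × ℝ => (q.1, q.2.1 / q.2.2)) (p, u, r) :=
      ContinuousAt.prodMk (by fun_prop) h2
    exact ContinuousAt.mul (by fun_prop) (hΦ.continuousAt.comp h3)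

/-- A parametrized Alexander trick: a continuous family of arcs in `[0,1] × ℝ` joining the two
sides of the strip is deformed, through such families, to the family of constant arcs at height
`0`. -/
theorem exists_strip_deformation {P : Type*} [TopologicalSpace P] [CompactSpace P]
    {X L : P × unitInterval → ℝ} (hX : Continuous X) (hL : Continuous L)
    (hXI : ∀ q, X q ∈ Icc (0 : ℝ) 1) (hX0 : ∀ p u, X (p, u) = 0 ↔ u = 0)
    (hX1 : ∀ p u, X (p, u) = 1 ↔ u = 1)
    (hinj : ∀ p u u', X (p, u) = X (p, u') → L (p, u) = L (p, u') → u = u') :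
    ∃ x v : P × unitInterval × unitInterval → ℝ, Continuous x ∧ Continuous v ∧
      (∀ p u, x (p, u, 0) = X (p, u) ∧ v (p, u, 0) = L (p, u)) ∧
      (∀ p u, x (p, u, 1) = u ∧ v (p, u, 1) = 0) ∧
      (∀ q, x q ∈ Icc (0 : ℝ) 1) ∧
      (∀ p u t, x (p, u, t) = 0 ↔ u = 0) ∧ (∀ p u t, x (p, u, t) = 1 ↔ u = 1) ∧
      (∀ p u u' t, x (p, u, t) = x (p, u', t) → v (p, u, t) = v (p, u', t) → u = u') ∧
      (∀ p t, v (p, 0, t) = (1 - t) * L (p, 0)) ∧ ∀ p t, v (p, 1, t) = (1 - t) * L (p, 1) := by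
  have hX0' : ∀ p, X (p, 0) = 0 := fun p => (hX0 p 0).2 rfl
  have hX1' : ∀ p, X (p, 1) = 1 := fun p => (hX1 p 1).2 rfl
  let pr : ℝ → unitInterval := fun w => projIcc 0 1 zero_le_one ((w + 1) / 2)
  have hpr : Continuous pr := continuous_projIcc.comp (by fun_prop)
  let lin : P → ℝ → ℝ := fun p y => (1 - y) * L (p, 0) + y * L (p, 1)
  have hlin : Continuous fun q : P × ℝ => lin q.1 q.2 := by fun_prop
  let f : P × unitInterval → ℝ := fun q => X q - q.2
  let g : P × unitInterval → ℝ := fun q => L q - lin q.1 (X q)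
  have hf : Continuous f := by fun_prop
  have hg : Continuous g := hL.sub (hlin.comp (continuous_fst.prodMk hX))
  have bdd : ∀ k : P × unitInterval → ℝ, Continuous k → ∃ B, ∀ q, |k q| ≤ B := fun k hk => by
    obtain ⟨B, hB⟩ := isCompact_univ.exists_bound_of_continuousOn hk.continuousOn
    exact ⟨B, fun q => hB q (mem_univ q)⟩
  have scale : ∀ k : P × unitInterval → ℝ, Continuous k → Continuous
      fun q : P × unitInterval × unitInterval =>
        (1 - (q.2.2 : ℝ)) * k (q.1, pr ((2 * q.2.1 - 1) / (1 - q.2.2))) := fun k hk => by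
    obtain ⟨B, hB⟩ := bdd k hk
    exact (continuous_mul_comp_div (Φ := fun q => k (q.1, pr q.2)) (by fun_prop)
      fun q => hB _).comp (g := fun q : P × ℝ × ℝ => q.2.2 * k (q.1, pr (q.2.1 / q.2.2)))
      (f := fun q : P × unitInterval × unitInterval =>
        (q.1, 2 * (q.2.1 : ℝ) - 1, 1 - (q.2.2 : ℝ))) (by fun_prop)
  let x : P × unitInterval × unitInterval → ℝ := fun q =>
    q.2.1 + (1 - (q.2.2 : ℝ)) * f (q.1, pr ((2 * q.2.1 - 1) / (1 - q.2.2)))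
  have hx : Continuous x := Continuous.add (by fun_prop) (scale f hf)
  let v : P × unitInterval × unitInterval → ℝ := fun q =>
    (1 - (q.2.2 : ℝ)) * g (q.1, pr ((2 * q.2.1 - 1) / (1 - q.2.2))) +
      (1 - (q.2.2 : ℝ)) * lin q.1 (x q)
  have hv : Continuous v := (scale g hg).add
    (Continuous.mul (by fun_prop) (hlin.comp (continuous_fst.prodMk hx)))
  have f0 : ∀ p, f (p, 0) = 0 := fun p => by simp [f, hX0']
  have f1 : ∀ p, f (p, 1) = 0 := fun p => by simp [f, hX1']
  have g0 : ∀ p, g (p, 0) = 0 := fun p => by simp [g, lin, hX0']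
  have g1 : ∀ p, g (p, 1) = 0 := fun p => by simp [g, lin, hX1']
  have key : ∀ (p : P) (u t : unitInterval), (1 - (t : ℝ) ≤ |2 * (u : ℝ) - 1| ∧ x (p, u, t) = u ∧
      v (p, u, t) = (1 - t) * lin p u) ∨
      (0 < 1 - (t : ℝ) ∧ ∃ y : unitInterval, 0 < (y : ℝ) ∧ (y : ℝ) < 1 ∧
        (u : ℝ) = 1 / 2 + (1 - t) * (y - 1 / 2) ∧ 0 < X (p, y) ∧ X (p, y) < 1 ∧
        x (p, u, t) = 1 / 2 + (1 - t) * (X (p, y) - 1 / 2) ∧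
        v (p, u, t) = (1 - t) * g (p, y) + (1 - t) * lin p (x (p, u, t))) := by
    intro p u t
    have ht0 : 0 ≤ 1 - (t : ℝ) := sub_nonneg.2 t.2.2
    rcases le_or_gt (1 - (t : ℝ)) |2 * (u : ℝ) - 1| with hu | hu
    · left
      have hz : (1 - (t : ℝ)) * f (p, pr ((2 * u - 1) / (1 - t))) = 0 ∧
          (1 - (t : ℝ)) * g (p, pr ((2 * u - 1) / (1 - t))) = 0 := by
        rcases ht0.eq_or_lt with h0 | h0
        · simp [← h0]
        · rcases le_abs.1 hu with h1 | h1
          · have : pr ((2 * u - 1) / (1 - t)) = 1 := projIcc_of_right_le _ (by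
              rw [le_div_iff₀ two_pos]
              linarith [(le_div_iff₀ h0).2 (by linarith : 1 * (1 - (t : ℝ)) ≤ 2 * u - 1)])
            simp [this, f1, g1]
          · have : pr ((2 * u - 1) / (1 - t)) = 0 := projIcc_of_le_left _ (by
              rw [div_le_iff₀ two_pos]
              linarith [(div_le_iff₀ h0).2 (by linarith : 2 * u - 1 ≤ (-1) * (1 - (t : ℝ)))])
            simp [this, f0, g0]
      have hxu : x (p, u, t) = u := by simp only [x, hz.1, add_zero]
      refine ⟨hu, hxu, ?_⟩
      simp only [v, hz.2, zero_add, hxu]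
    · right
      have h0 : 0 < 1 - (t : ℝ) := (abs_nonneg _).trans_lt hu
      obtain ⟨h1, h2⟩ := abs_lt.1 hu
      have h3 : -1 < (2 * (u : ℝ) - 1) / (1 - t) := (lt_div_iff₀ h0).2 (by linarith)
      have h4 : (2 * (u : ℝ) - 1) / (1 - t) < 1 := (div_lt_iff₀ h0).2 (by linarith)
      have h5 : (pr ((2 * u - 1) / (1 - t)) : ℝ) = ((2 * (u : ℝ) - 1) / (1 - t) + 1) / 2 := by
        simp only [pr]
        rw [projIcc_of_mem zero_le_one (x := ((2 * (u : ℝ) - 1) / (1 - t) + 1) / 2)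
          ⟨by linarith, by linarith⟩]
      have hu' : (u : ℝ) = 1 / 2 + (1 - t) * (pr ((2 * u - 1) / (1 - t)) - 1 / 2) := by
        rw [h5]
        field_simp
        ring
      have y0 : 0 < (pr ((2 * u - 1) / (1 - t)) : ℝ) := by rw [h5]; linarith
      have y1 : (pr ((2 * u - 1) / (1 - t)) : ℝ) < 1 := by rw [h5]; linarith
      refine ⟨h0, pr ((2 * u - 1) / (1 - t)), y0, y1, hu', ?_, ?_, ?_, rfl⟩
      · refine lt_of_le_of_ne (hXI _).1 fun h => ?_
        rw [(hX0 _ _).1 h.symm] at y0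
        exact lt_irrefl _ y0
      · refine lt_of_le_of_ne (hXI _).2 fun h => ?_
        rw [(hX1 _ _).1 h] at y1
        exact lt_irrefl _ y1
      · simp only [x, f]
        nth_rewrite 1 [hu']
        ring
  have hcoe : ∀ u : unitInterval, (u : ℝ) = 0 ↔ u = 0 := fun u => by simp
  have hcoe1 : ∀ u : unitInterval, (u : ℝ) = 1 ↔ u = 1 := fun u => by simp
  have small : ∀ {r y : ℝ}, 0 < r → 0 < y → y < 1 →
      |2 * (1 / 2 + r * (y - 1 / 2)) - 1| < r := fun hr hy hy' => by
    rw [abs_lt]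
    constructor <;> nlinarith
  have strict : ∀ {r y : ℝ}, 0 < r → r ≤ 1 → 0 < y → y < 1 →
      0 < 1 / 2 + r * (y - 1 / 2) ∧ 1 / 2 + r * (y - 1 / 2) < 1 := fun hr hr' hy hy' => by
    constructor <;> nlinarith
  refine ⟨x, v, hx, hv, fun p u => ?_, fun p u => ?_, ?_, fun p u t => ?_, fun p u t => ?_,
    fun p u u' t ex ev => ?_, fun p t => ?_, fun p t => ?_⟩
  · rcases key p u 0 with ⟨h1, h2, h3⟩ | ⟨-, y, -, -, h3, -, -, h4, h5⟩
    · have hu : u = 0 ∨ u = 1 := by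
        have := u.2.1
        have := u.2.2
        simp only [Icc.coe_zero, sub_zero] at h1
        rcases le_abs.1 h1 with h | h
        · exact Or.inr ((hcoe1 u).1 (by linarith))
        · exact Or.inl ((hcoe u).1 (by linarith))
      rw [h2, h3]
      rcases hu with rfl | rfl
      · simp [hX0', lin]
      · simp [hX1', lin]
    · have hy : u = y := Subtype.ext (by simpa using h3)
      rw [hy] at h4 h5 ⊢
      have h6 : x (p, y, 0) = X (p, y) := by rw [h4]; simp
      refine ⟨h6, ?_⟩
      rw [h5, h6]
      simp [g]
  · rcases key p u 1 with ⟨h1, h2, h3⟩ | ⟨h, -⟩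
    · exact ⟨h2, by rw [h3]; simp⟩
    · simp at h
  · rintro ⟨p, u, t⟩
    rcases key p u t with ⟨-, h, -⟩ | ⟨h0, y, -, -, -, h1, h2, h3, -⟩
    · rw [h]
      exact u.2
    · rw [h3]
      have := strict h0 (by linarith [t.2.1]) h1 h2
      exact ⟨this.1.le, this.2.le⟩
  · rcases key p u t with ⟨-, h, -⟩ | ⟨h0, y, y0, y1, hu, h1, h2, h3, -⟩
    · rw [h, hcoe]
    · have a1 := (strict h0 (by linarith [t.2.1]) h1 h2).1
      have a2 := (strict h0 (by linarith [t.2.1]) y0 y1).1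
      rw [← h3] at a1
      rw [← hu] at a2
      exact ⟨fun h => absurd h a1.ne', fun h => absurd ((hcoe u).2 h) a2.ne'⟩
  · rcases key p u t with ⟨-, h, -⟩ | ⟨h0, y, y0, y1, hu, h1, h2, h3, -⟩
    · rw [h, hcoe1]
    · have a1 := (strict h0 (by linarith [t.2.1]) h1 h2).2
      have a2 := (strict h0 (by linarith [t.2.1]) y0 y1).2
      rw [← h3] at a1
      rw [← hu] at a2
      exact ⟨fun h => absurd h a1.ne, fun h => absurd ((hcoe1 u).2 h) a2.ne⟩
  · rcases key p u t with ⟨h1, h2, -⟩ | ⟨h0, y, -, -, hu, h1, h2, h3, h4⟩ <;>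
      rcases key p u' t with ⟨k1, k2, -⟩ | ⟨k0, y', -, -, ku, k1, k2, k3, k4⟩
    · exact Subtype.ext (h2.symm.trans (ex.trans k2))
    · rw [← h2, ex, k3] at h1
      exact absurd (small k0 k1 k2) h1.not_gt
    · rw [← k2, ← ex, h3] at k1
      exact absurd (small h0 h1 h2) k1.not_gt
    · have e1 : X (p, y) = X (p, y') := by
        rw [h3, k3] at ex
        have := mul_left_cancel₀ h0.ne' (add_left_cancel ex)
        linarith
      have e2 : L (p, y) = L (p, y') := by
        rw [h4, k4, ex] at ev
        have := mul_left_cancel₀ h0.ne' (add_right_cancel ev)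
        simp only [g, e1] at this
        exact sub_left_injective this
      rw [← hinj p y y' e1 e2] at ku
      exact Subtype.ext (hu.trans ku.symm)
  · rcases key p 0 t with ⟨-, -, h⟩ | ⟨h0, y, y0, y1, hu, -⟩
    · simpa [lin] using h
    · have := (strict h0 (by linarith [t.2.1]) y0 y1).1
      rw [← hu] at this
      simp at this
  · rcases key p 1 t with ⟨-, -, h⟩ | ⟨h0, y, y0, y1, hu, -⟩
    · simpa [lin] using h
    · have := (strict h0 (by linarith [t.2.1]) y0 y1).2
      rw [← hu] at this
      simp at this

theorem sigmoid_log_sub_log {s : ℝ} (hs : s ∈ Ioo (0 : ℝ) 1) :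
    Real.sigmoid (Real.log s - Real.log (1 - s)) = s := by
  have h1 : 0 < 1 - s := sub_pos.2 hs.2
  have h0 := hs.1
  rw [Real.sigmoid_def, neg_sub, Real.exp_sub, Real.exp_log h1, Real.exp_log h0]
  field_simp
  ring

namespace IsDoubleSusp

variable {C₁ C₂ X Z : Type*} [TopologicalSpace C₁] [TopologicalSpace C₂]
    [TopologicalSpace X] [TopologicalSpace Z] {Q : C₁ → C₂ → ℝ → ℝ → X} {α : X → C₁} {β : X → C₂}
    {ξ σ : X → ℝ} {S : Z → ℝ → X} {ζ : X → Z} {τ : X → ℝ}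

theorem exists_isotopy [CompactSpace C₁] [CompactSpace C₂] [T2Space C₁] [T2Space C₂]
    [TotallyDisconnectedSpace C₁] [TotallyDisconnectedSpace C₂] [Infinite C₁] [Infinite C₂]
    [CompactSpace Z] [TopologicalSpace.MetrizableSpace Z] [T2Space X]
    (h : IsDoubleSusp Q α β ξ σ S ζ τ) :
    ∃ H : Z × unitInterval → X, Continuous H ∧ (∀ z, H (z, 0) = S z (1 / 2)) ∧
      (∀ t, IsEmbedding fun z => H (z, t)) ∧
      range (fun z => H (z, 1)) = {m | ∃ a b, ∃ x : unitInterval, m = Q a b x (1 / 2)} := by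
  obtain ⟨E, hE, hE0, hE1, hEi, hEr⟩ := h.exists_sheet_parametrization
  obtain ⟨k0, k1, hEe⟩ := h.sheet_parametrization_eq_iff hE0 hE1 hEi hEr
  have hEs : ∀ z, ∃ q : (C₁ × C₂) × unitInterval, E q.1.1 q.1.2 q.2 = z := fun z => by
    obtain ⟨u, hu⟩ := (hEr (α (S z (1 / 2))) (β (S z (1 / 2))) z).2 (h.join.mk_coord _)
    exact ⟨((_, _), u), hu⟩
  have hEc : Continuous fun q : (C₁ × C₂) × unitInterval => E q.1.1 q.1.2 q.2 :=
    hE.comp (g := fun q : C₁ × C₂ × unitInterval => E q.1 q.2.1 q.2.2)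
      (f := fun q : (C₁ × C₂) × unitInterval => (q.1.1, q.1.2, q.2)) (by fun_prop)
  let ι : (C₁ × C₂) × unitInterval → X := fun q => S (E q.1.1 q.1.2 q.2) (1 / 2)
  have hι : Continuous ι := h.continuous_mid.comp hEc
  have hσι : ∀ q, σ (ι q) ∈ Ioo (0 : ℝ) 1 := fun q => h.σ_mid _
  have hιQ : ∀ q, Q q.1.1 q.1.2 (ξ (ι q)) (σ (ι q)) = ι q := fun q =>
    (hEr _ _ _).1 ⟨q.2, rfl⟩
  let L : (C₁ × C₂) × unitInterval → ℝ := fun q => Real.log (σ (ι q)) - Real.log (1 - σ (ι q))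
  have hL : Continuous L := by
    have := h.join.cont_σ.comp hι
    exact (this.log fun q => (hσι q).1.ne').sub
      ((continuous_const.sub this).log fun q => (sub_pos.2 (hσι q).2).ne')
  have hLσ : ∀ q, Real.sigmoid (L q) = σ (ι q) := fun q => sigmoid_log_sub_log (hσι q)
  have half : (1 / 2 : ℝ) ∈ Icc (0 : ℝ) 1 := by norm_num
  obtain ⟨x, v, hx, hv, hxv0, hxv1, hxI, hx0, hx1, hinj, hv0, hv1⟩ := exists_strip_deformation
    (X := fun q => ξ (ι q)) (L := L) (h.continuous_ξ_mid.comp hEc) hL (fun q => h.join.ξ_mem _)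
    (fun p u => k0 p.1 p.2 u) (fun p u => k1 p.1 p.2 u) (fun p u u' e1 e2 => by
      have e3 : σ (ι (p, u)) = σ (ι (p, u')) := by rw [← hLσ, ← hLσ, e2]
      have e4 : ι (p, u) = ι (p, u') := by rw [← hιQ, ← hιQ (p, u'), e1, e3]
      have := ((h.susp.eq_iff _ _ _ half _ half).1 e4).2
      norm_num at this
      exact hEi _ _ this)
  let G : (C₁ × C₂) × unitInterval × unitInterval → X := fun q =>
    Q q.1.1 q.1.2 (x q) (Real.sigmoid (v q))
  have hG : Continuous G := h.join.cont.comp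
    (g := fun p : C₁ × C₂ × ℝ × ℝ => Q p.1 p.2.1 p.2.2.1 p.2.2.2)
    (f := fun q : (C₁ × C₂) × unitInterval × unitInterval =>
      (q.1.1, q.1.2, x q, Real.sigmoid (v q)))
    (Continuous.prodMk (by fun_prop) (Continuous.prodMk (by fun_prop)
      (hx.prodMk (continuous_sigmoid.comp hv))))
  have hsI : ∀ r : ℝ, Real.sigmoid r ∈ Icc (0 : ℝ) 1 := fun r =>
    ⟨(Real.sigmoid_pos r).le, (Real.sigmoid_lt_one r).le⟩
  have hGe : ∀ p u p' u' t, G (p, u, t) = G (p', u', t) ↔ E p.1 p.2 u = E p'.1 p'.2 u' := by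
    intro p u p' u' t
    have hG1 : G (p, u, t) = G (p', u', t) ↔ v (p, u, t) = v (p', u', t) ∧
        x (p, u, t) = x (p', u', t) ∧ (u = 1 ∨ p.1 = p'.1) ∧ (u = 0 ∨ p.2 = p'.2) := by
      rw [← hx0 p u t, ← hx1 p u t]
      refine (h.join.eq_iff _ _ _ _ _ (hxI _) _ (hxI _) _ (hsI _) _ (hsI _)).trans ?_
      rw [Real.sigmoid_injective.eq_iff]
      simp only [(Real.sigmoid_pos _).ne', (Real.sigmoid_lt_one _).ne, false_or]
    rw [hG1]
    constructor
    · rintro ⟨e1, e2, e3, e4⟩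
      refine (hEe _ _ _ _ _ _).2 ⟨?_, e3, e4⟩
      by_cases hu1 : u = 1
      · rw [hu1, eq_comm, ← hx1 p' u' t, ← e2, hx1, hu1]
      by_cases hu0 : u = 0
      · rw [hu0, eq_comm, ← hx0 p' u' t, ← e2, hx0, hu0]
      have hp : p = p' := Prod.ext (e3.resolve_left hu1) (e4.resolve_left hu0)
      subst hp
      exact hinj p u u' t e2 e1
    · intro e
      obtain ⟨rfl, e3, e4⟩ := (hEe _ _ _ _ _ _).1 e
      have eL : L (p, u) = L (p', u) := by simp only [L, ι, e]
      by_cases hu1 : u = 1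
      · subst hu1
        refine ⟨?_, ?_, e3, e4⟩
        · rw [hv1, hv1, eL]
        · rw [(hx1 _ _ _).2 rfl, (hx1 _ _ _).2 rfl]
      by_cases hu0 : u = 0
      · subst hu0
        refine ⟨?_, ?_, e3, e4⟩
        · rw [hv0, hv0, eL]
        · rw [(hx0 _ _ _).2 rfl, (hx0 _ _ _).2 rfl]
      have hp : p = p' := Prod.ext (e3.resolve_left hu1) (e4.resolve_left hu0)
      subst hp
      exact ⟨rfl, rfl, e3, e4⟩
  choose c hc using hEs
  let H : Z × unitInterval → X := fun q => G ((c q.1).1, (c q.1).2, q.2)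
  have hHG : ∀ p u t, H (E p.1 p.2 u, t) = G (p, u, t) := fun p u t => (hGe _ _ _ _ _).2 (hc _)
  have hH : Continuous H := by
    refine continuous_of_comp_surjective (q := fun q : ((C₁ × C₂) × unitInterval) × unitInterval =>
      (E q.1.1.1 q.1.1.2 q.1.2, q.2)) ((hEc.comp continuous_fst).prodMk continuous_snd) ?_ ?_
    · rintro ⟨z, t⟩
      exact ⟨(c z, t), Prod.ext (hc z) rfl⟩
    · have : Continuous fun q : ((C₁ × C₂) × unitInterval) × unitInterval =>
          G (q.1.1, q.1.2, q.2) := hG.comp (by fun_prop)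
      exact this.congr fun q => (hHG q.1.1 q.1.2 q.2).symm
  refine ⟨H, hH, fun z => ?_, fun t => ?_, ?_⟩
  · have e := hxv0 (c z).1 (c z).2
    simp only [H, G, e.1, e.2, hLσ]
    rw [hιQ]
    simp only [ι, hc]
  · have hHt : Continuous fun z => H (z, t) := hH.comp (by fun_prop)
    refine (hHt.isClosedEmbedding fun z z' e => ?_).isEmbedding
    have := (hGe _ _ _ _ _).1 e
    rwa [hc, hc] at this
  · have e : ∀ p u, G (p, u, 1) = Q p.1 p.2 u (1 / 2) := fun p u => by
      simp only [G, (hxv1 p u).1, (hxv1 p u).2, Real.sigmoid_zero, one_div]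
    ext m
    constructor
    · rintro ⟨z, rfl⟩
      exact ⟨_, _, (c z).2, e _ _⟩
    · rintro ⟨a, b, u, rfl⟩
      exact ⟨E a b u, (hHG (a, b) u 1).trans (e (a, b) u)⟩

end IsDoubleSusp

theorem equivalence_suspRel (W : Type u) : Equivalence (suspRel W) where
  refl _ := Or.inl rfl
  symm {a b} h := by
    unfold suspRel at *
    rw [eq_comm]
    tauto
  trans {a b c} h h' := by
    unfold suspRel at *
    rcases h with rfl | h
    · exact h'
    rcases h' with rfl | h'
    · exact Or.inr h
    have := zero_ne_one (α := unitInterval)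
    grind

theorem suspMk_eq_iff {W : Type u} [TopologicalSpace W] {w w' : W} {t t' : unitInterval} :
    suspMk W w t = suspMk W w' t' ↔ t = t' ∧ (t = 0 ∨ t = 1 ∨ w = w') := by
  have : suspMk W w t = suspMk W w' t' ↔ suspRel W (w, t) (w', t') :=
    ⟨fun e => (equivalence_suspRel W).eqvGen_iff.1 (Quot.eqvGen_exact e), fun e => Quot.sound e⟩
  rw [this]
  simp only [suspRel, Prod.mk.injEq]
  grind

theorem continuous_suspMk (W : Type u) [TopologicalSpace W] :
    Continuous fun p : W × unitInterval => suspMk W p.1 p.2 := continuous_quot_mk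

theorem exists_suspMk_eq {W : Type u} [TopologicalSpace W] (m : Susp W) :
    ∃ w t, suspMk W w t = m := by
  obtain ⟨⟨w, t⟩, rfl⟩ := Quot.exists_rep m
  exact ⟨w, t, rfl⟩

theorem continuous_susp_of_comp {W : Type u} [TopologicalSpace W] {Y : Type*} [TopologicalSpace Y]
    {f : Susp W → Y} (hf : Continuous fun p : W × unitInterval => f (suspMk W p.1 p.2)) :
    Continuous f := isQuotientMap_quot_mk.continuous_iff.2 hf

theorem compactSpace_susp (W : Type u) [TopologicalSpace W] [CompactSpace W] :
    CompactSpace (Susp W) :=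
  inferInstanceAs (CompactSpace (Quot (suspRel W)))

theorem equivalence_joinRel (C₁ C₂ : Type u) : Equivalence (joinRel C₁ C₂) where
  refl _ := Or.inl rfl
  symm {a b} h := by
    unfold joinRel at *
    rw [eq_comm]
    tauto
  trans {a b c} h h' := by
    unfold joinRel at *
    rcases h with rfl | h
    · exact h'
    rcases h' with rfl | h'
    · exact Or.inr h
    have := zero_ne_one (α := unitInterval)
    grind

section Join

variable {C₁ C₂ : Type u} [TopologicalSpace C₁] [TopologicalSpace C₂]

theorem joinMk_eq_iff {a a' : C₁} {b b' : C₂} {t t' : unitInterval} :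
    joinMk C₁ C₂ a b t = joinMk C₁ C₂ a' b' t' ↔
      t = t' ∧ (t = 1 ∨ a = a') ∧ (t = 0 ∨ b = b') := by
  have : joinMk C₁ C₂ a b t = joinMk C₁ C₂ a' b' t' ↔ joinRel C₁ C₂ (a, b, t) (a', b', t') :=
    ⟨fun e => (equivalence_joinRel C₁ C₂).eqvGen_iff.1 (Quot.eqvGen_exact e),
      fun e => Quot.sound e⟩
  rw [this]
  simp only [joinRel, Prod.mk.injEq]
  have := zero_ne_one (α := unitInterval)
  grind

theorem continuous_joinMk :
    Continuous fun p : C₁ × C₂ × unitInterval => joinMk C₁ C₂ p.1 p.2.1 p.2.2 :=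
  continuous_quot_mk

theorem exists_joinMk_eq (m : TopJoin C₁ C₂) : ∃ a b t, joinMk C₁ C₂ a b t = m := by
  obtain ⟨⟨a, b, t⟩, rfl⟩ := Quot.exists_rep m
  exact ⟨a, b, t, rfl⟩

theorem continuous_topJoin_of_comp {Y : Type*} [TopologicalSpace Y] {f : TopJoin C₁ C₂ → Y}
    (hf : Continuous fun p : C₁ × C₂ × unitInterval => f (joinMk C₁ C₂ p.1 p.2.1 p.2.2)) :
    Continuous f := isQuotientMap_quot_mk.continuous_iff.2 hf

theorem compactSpace_topJoin [CompactSpace C₁] [CompactSpace C₂] :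
    CompactSpace (TopJoin C₁ C₂) :=
  inferInstanceAs (CompactSpace (Quot (joinRel C₁ C₂)))

theorem exists_continuous_injective_topJoin {M₁ M₂ : Type*}
    [AddCommGroup M₁] [Module ℝ M₁] [TopologicalSpace M₁] [ContinuousSMul ℝ M₁]
    [AddCommGroup M₂] [Module ℝ M₂] [TopologicalSpace M₂] [ContinuousSMul ℝ M₂]
    {g₁ : C₁ → M₁} {g₂ : C₂ → M₂} (hg₁ : Continuous g₁) (hg₂ : Continuous g₂)
    (hi₁ : Function.Injective g₁) (hi₂ : Function.Injective g₂) :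
    ∃ f : TopJoin C₁ C₂ → ℝ × M₁ × M₂, Continuous f ∧ Function.Injective f := by
  let f : TopJoin C₁ C₂ → ℝ × M₁ × M₂ := Quot.lift
    (fun p => ((p.2.2 : ℝ), (1 - (p.2.2 : ℝ)) • g₁ p.1, (p.2.2 : ℝ) • g₂ p.2.1)) (by
      rintro ⟨a, b, t⟩ ⟨a', b', t'⟩ (h | ⟨h, h', e⟩ | ⟨h, h', e⟩)
      · rw [h]
      · dsimp at h h' e
        simp [h, h', e]
      · dsimp at h h' e
        simp [h, h', e])
  refine ⟨f, continuous_topJoin_of_comp ?_, fun m m' e => ?_⟩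
  · change Continuous fun p : C₁ × C₂ × unitInterval =>
      ((p.2.2 : ℝ), (1 - (p.2.2 : ℝ)) • g₁ p.1, (p.2.2 : ℝ) • g₂ p.2.1)
    fun_prop
  · obtain ⟨a, b, t, rfl⟩ := exists_joinMk_eq m
    obtain ⟨a', b', t', rfl⟩ := exists_joinMk_eq m'
    have e' : ((t : ℝ), (1 - (t : ℝ)) • g₁ a, (t : ℝ) • g₂ b) =
      ((t' : ℝ), (1 - (t' : ℝ)) • g₁ a', (t' : ℝ) • g₂ b') := e
    simp only [Prod.mk.injEq] at e'
    obtain ⟨h1, h2, h3⟩ := e'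
    have ht : t = t' := Subtype.ext h1
    subst ht
    refine joinMk_eq_iff.2 ⟨rfl, ?_, ?_⟩
    · refine or_iff_not_imp_left.2 fun h => hi₁ (smul_right_injective M₁ (r := 1 - (t : ℝ)) ?_ h2)
      exact sub_ne_zero.2 fun h' => h (Subtype.ext h'.symm)
    · refine or_iff_not_imp_left.2 fun h => hi₂ (smul_right_injective M₂ (r := (t : ℝ)) ?_ h3)
      exact fun h' => h (Subtype.ext h')

end Join

theorem exists_continuous_injective_susp {W : Type u} [TopologicalSpace W] {M : Type*}
    [AddCommGroup M] [Module ℝ M] [TopologicalSpace M] [ContinuousSMul ℝ M] {g : W → M}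
    (hg : Continuous g) (hi : Function.Injective g) :
    ∃ f : Susp W → ℝ × M, Continuous f ∧ Function.Injective f := by
  let f : Susp W → ℝ × M := Quot.lift
    (fun p => ((p.2 : ℝ), ((p.2 : ℝ) * (1 - (p.2 : ℝ))) • g p.1)) (by
      rintro ⟨a, t⟩ ⟨a', t'⟩ (h | ⟨h, h'⟩ | ⟨h, h'⟩)
      · rw [h]
      · dsimp at h h'
        simp [h, h']
      · dsimp at h h'
        simp [h, h'])
  refine ⟨f, continuous_susp_of_comp ?_, fun m m' e => ?_⟩
  · change Continuous fun p : W × unitInterval =>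
      ((p.2 : ℝ), ((p.2 : ℝ) * (1 - (p.2 : ℝ))) • g p.1)
    fun_prop
  · obtain ⟨a, t, rfl⟩ := exists_suspMk_eq m
    obtain ⟨a', t', rfl⟩ := exists_suspMk_eq m'
    have e' : ((t : ℝ), ((t : ℝ) * (1 - (t : ℝ))) • g a) =
      ((t' : ℝ), ((t' : ℝ) * (1 - (t' : ℝ))) • g a') := e
    simp only [Prod.mk.injEq] at e'
    obtain ⟨h1, h2⟩ := e'
    have ht : t = t' := Subtype.ext h1
    subst ht
    refine suspMk_eq_iff.2 ⟨rfl, ?_⟩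
    refine or_iff_not_imp_left.2 fun h => or_iff_not_imp_left.2 fun h' =>
      hi (smul_right_injective M (r := (t : ℝ) * (1 - (t : ℝ))) ?_ h2)
    exact mul_ne_zero (fun k => h (Subtype.ext k))
      (sub_ne_zero.2 fun k => h' (Subtype.ext k.symm))

/-- The Cantor space embeds in `ℕ → ℝ`. -/
theorem exists_continuous_injective_of_homeomorph {C : Type*} [TopologicalSpace C]
    (e : C ≃ₜ (ℕ → Bool)) : ∃ g : C → ℕ → ℝ, Continuous g ∧ Function.Injective g := by
  refine ⟨fun a n => if e a n then 1 else 0, ?_, fun a a' h => ?_⟩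
  · refine continuous_pi fun n => ?_
    exact (continuous_of_discreteTopology (f := fun i : Bool => if i then (1 : ℝ) else 0)).comp
      ((continuous_apply n).comp e.continuous)
  · refine e.injective (funext fun n => ?_)
    have := congrFun h n
    dsimp only at this
    cases h1 : e a n <;> cases h2 : e a' n <;> simp_all

theorem metrizableSpace_susp_topJoin {C₁ C₂ : Type u}
    [TopologicalSpace C₁] [TopologicalSpace C₂] [CompactSpace C₁] [CompactSpace C₂]
    (e₁ : C₁ ≃ₜ (ℕ → Bool)) (e₂ : C₂ ≃ₜ (ℕ → Bool)) :
    TopologicalSpace.MetrizableSpace (Susp (TopJoin C₁ C₂)) := by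
  obtain ⟨g₁, hg₁, hi₁⟩ := exists_continuous_injective_of_homeomorph e₁
  obtain ⟨g₂, hg₂, hi₂⟩ := exists_continuous_injective_of_homeomorph e₂
  obtain ⟨g, hg, hi⟩ := exists_continuous_injective_topJoin hg₁ hg₂ hi₁ hi₂
  obtain ⟨f, hf, hif⟩ := exists_continuous_injective_susp hg hi
  have := compactSpace_topJoin (C₁ := C₁) (C₂ := C₂)
  have := compactSpace_susp (TopJoin C₁ C₂)
  exact (hf.isClosedEmbedding hif).isEmbedding.metrizableSpace

theorem nhdsNE_neBot_of_homeomorph {C : Type*} [TopologicalSpace C] (e : C ≃ₜ (ℕ → Bool)) (a : C) :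
    (𝓝[≠] a).NeBot := by
  have h1 : Tendsto (fun n => Function.update (e a) n (!e a n)) atTop (𝓝 (e a)) := by
    refine tendsto_pi_nhds.2 fun i => tendsto_const_nhds.congr' ?_
    filter_upwards [eventually_gt_atTop i] with n hn
    rw [Function.update_of_ne hn.ne]
  have h2 : Tendsto (fun n => e.symm (Function.update (e a) n (!e a n))) atTop (𝓝[≠] a) := by
    refine tendsto_nhdsWithin_iff.2 ⟨?_, Eventually.of_forall fun n => ?_⟩
    · have := (e.symm.continuous.tendsto (e a)).comp h1
      rwa [e.symm_apply_apply] at this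
    · intro h
      have h3 : Function.update (e a) n (!e a n) = e a := by
        rw [← e.symm_apply_eq]
        exact h
      simpa using congrFun h3 n
  exact h2.neBot

theorem isClosed_of_suspMk_half {X : Type u} [TopologicalSpace X] {Z : Set X} (h : Susp ↥Z ≃ₜ X)
    {c : unitInterval} (hr : ∀ z : Z, h (suspMk ↥Z z c) = ↑z) :
    IsClosed Z := by
  let k : Susp ↥Z → unitInterval := Quot.lift (fun p => p.2) (by
      rintro ⟨a, t⟩ ⟨a', t'⟩ (h | ⟨h, h'⟩ | ⟨h, h'⟩)
      · rw [h]
      · exact h.trans h'.symm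
      · exact h.trans h'.symm)
  have hk : Continuous k := continuous_susp_of_comp continuous_snd
  have hZ : Z = h '' (k ⁻¹' {c}) := by
    ext m
    constructor
    · exact fun hm => ⟨suspMk ↥Z ⟨m, hm⟩ c, rfl, hr ⟨m, hm⟩⟩
    · rintro ⟨s, hs, rfl⟩
      obtain ⟨z, t, rfl⟩ := exists_suspMk_eq s
      have ht : t = c := hs
      rw [ht, hr]
      exact z.2
  rw [hZ]
  exact h.isClosedMap _ (isClosed_singleton.preimage hk)

/-- With `Z ⊆ ΣY` and `h : ΣZ ≃ₜ ΣY` restricting to the inclusion on `Z`, the subspace `Z`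
is isotopic in `ΣY` to the copy of `Y` (the image of `Y × {1/2}`): there is a continuous
`H : Z × [0,1] → ΣY` starting at the inclusion, an embedding at each time, and ending in a
homeomorphism of `Z` onto the copy of `Y`. -/
theorem Z_isotopic_to_join (C₁ C₂ : Type u)
    [TopologicalSpace C₁] [TopologicalSpace C₂]
    (e₁ : C₁ ≃ₜ (ℕ → Bool)) (e₂ : C₂ ≃ₜ (ℕ → Bool))
    (Z : Set (Susp (TopJoin C₁ C₂)))
    (h : Susp ↥Z ≃ₜ Susp (TopJoin C₁ C₂))
    (hrestr : ∀ z : Z, h (suspMk ↥Z z ⟨1/2, by norm_num [Set.mem_Icc]⟩) = ↑z) :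
    ∃ H : ↥Z × unitInterval → Susp (TopJoin C₁ C₂),
      Continuous H ∧
      (∀ z : Z, H (z, 0) = ↑z) ∧
      (∀ t : unitInterval, Topology.IsEmbedding (fun z : Z => H (z, t))) ∧
      Set.range (fun z : Z => H (z, 1)) =
        {x | ∃ y : TopJoin C₁ C₂,
          x = suspMk (TopJoin C₁ C₂) y ⟨1/2, by norm_num [Set.mem_Icc]⟩} := by
  have half : (1 / 2 : ℝ) ∈ Icc (0 : ℝ) 1 := by norm_num
  have : CompactSpace C₁ := e₁.symm.compactSpace
  have : CompactSpace C₂ := e₂.symm.compactSpace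
  have : T2Space C₁ := e₁.isEmbedding.t2Space
  have : T2Space C₂ := e₂.isEmbedding.t2Space
  have : TotallyDisconnectedSpace C₁ :=
    ⟨e₁.isEmbedding.isTotallyDisconnected (isTotallyDisconnected_of_totallyDisconnectedSpace _)⟩
  have : TotallyDisconnectedSpace C₂ :=
    ⟨e₂.isEmbedding.isTotallyDisconnected (isTotallyDisconnected_of_totallyDisconnectedSpace _)⟩
  have : Infinite C₁ := Infinite.of_injective e₁.symm e₁.symm.injective
  have : Infinite C₂ := Infinite.of_injective e₂.symm e₂.symm.injective
  have := compactSpace_topJoin (C₁ := C₁) (C₂ := C₂)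
  have := compactSpace_susp (TopJoin C₁ C₂)
  have := metrizableSpace_susp_topJoin e₁ e₂
  have : CompactSpace Z := isCompact_iff_compactSpace.1 (isClosed_of_suspMk_half h hrestr).isCompact
  let I : ℝ → unitInterval := projIcc 0 1 zero_le_one
  have hI : Continuous I := continuous_projIcc
  have I0 : ∀ s ∈ Icc (0 : ℝ) 1, (I s = 0 ↔ s = 0) := fun s hs => by
    rw [show I s = ⟨s, hs⟩ from projIcc_of_mem _ hs, Subtype.ext_iff]
    rfl
  have I1 : ∀ s ∈ Icc (0 : ℝ) 1, (I s = 1 ↔ s = 1) := fun s hs => by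
    rw [show I s = ⟨s, hs⟩ from projIcc_of_mem _ hs, Subtype.ext_iff]
    rfl
  have II : ∀ s ∈ Icc (0 : ℝ) 1, ∀ s' ∈ Icc (0 : ℝ) 1, (I s = I s' ↔ s = s') := fun s hs s' hs' =>
    ⟨fun e => (strictMonoOn_projIcc zero_le_one).injOn hs hs' e, fun e => by rw [e]⟩
  have Ic : ∀ s : unitInterval, I s = s := projIcc_val _
  have Ih : I (1 / 2) = ⟨1 / 2, half⟩ := projIcc_of_mem _ half
  obtain ⟨α, β, ξ, σ, hQ⟩ := IsJoinSusp.exists_coords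
    (fun a b x s => suspMk (TopJoin C₁ C₂) (joinMk C₁ C₂ a b (I x)) (I s))
    ((continuous_suspMk _).comp ((continuous_joinMk.comp
      (f := fun p : C₁ × C₂ × ℝ × ℝ => (p.1, p.2.1, I p.2.2.1)) (by fun_prop)).prodMk
      (g := fun p : C₁ × C₂ × ℝ × ℝ => I p.2.2.2) (by fun_prop)))
    (fun m => by
      obtain ⟨y, s, rfl⟩ := exists_suspMk_eq m
      obtain ⟨a, b, x, rfl⟩ := exists_joinMk_eq y
      exact ⟨a, b, x, x.2, s, s.2, by rw [Ic, Ic]⟩)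
    (fun a b a' b' x hx x' hx' s hs s' hs' => by
      rw [suspMk_eq_iff, joinMk_eq_iff, II s hs s' hs', I0 s hs, I1 s hs, I0 x hx, I1 x hx,
        II x hx x' hx'])
  obtain ⟨ζ, τ, hS⟩ := IsSusp.exists_coords (fun (z : Z) s => h (suspMk ↥Z z (I s)))
    (h.continuous.comp ((continuous_suspMk _).comp
      (f := fun p : Z × ℝ => (p.1, I p.2)) (by fun_prop)))
    (fun m => by
      obtain ⟨z, s, e⟩ := exists_suspMk_eq (h.symm m)
      exact ⟨z, s, s.2, by rw [Ic, e, h.apply_symm_apply]⟩)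
    (fun z z' s hs s' hs' => by
      rw [h.injective.eq_iff, suspMk_eq_iff, II s hs s' hs', I0 s hs, I1 s hs])
  obtain ⟨S, τ, hS, hmid, hbot, htop⟩ := hQ.exists_same_poles hS (nhdsNE_neBot_of_homeomorph e₁)
    (nhdsNE_neBot_of_homeomorph e₂)
  obtain ⟨H, hH, hH0, hHt, hH1⟩ := IsDoubleSusp.exists_isotopy ⟨hQ, hS, hbot, htop⟩
  refine ⟨H, hH, fun z => ?_, hHt, hH1.trans ?_⟩
  · rw [hH0, hmid, Ih, hrestr]
  · ext m
    constructor
    · rintro ⟨a, b, x, rfl⟩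
      exact ⟨_, by rw [Ih]⟩
    · rintro ⟨y, rfl⟩
      obtain ⟨a, b, x, rfl⟩ := exists_joinMk_eq y
      exact ⟨a, b, x, by rw [Ih, Ic]⟩
end

section
/- (Moore's characterization of the arc) Let A be a compact connected metric space with at least two points. If A has exactly two non-cut points, then A is homeomorphic to the closed interval [0,1]. (A point z of A is a cut point if the subspace A \ {z} is disconnected; a non-cut point is a point that is not a cut point.) -/
open Set

universe u

open Topology

/-- `U` and `V` are disjoint open sets partitioning the complement of the point `z`. -/
structure IsPointSeparation {X : Type*} [TopologicalSpace X] (z : X) (U V : Set X) : Prop where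
  isOpen_left : IsOpen U
  isOpen_right : IsOpen V
  disjoint : Disjoint U V
  union_eq : U ∪ V = {z}ᶜ

namespace IsPointSeparation

variable {X : Type*} [TopologicalSpace X] {x y z : X} {U V U' V' S : Set X}

theorem symm (h : IsPointSeparation z U V) : IsPointSeparation z V U :=
  ⟨h.isOpen_right, h.isOpen_left, h.disjoint.symm, by rw [union_comm, h.union_eq]⟩

theorem mem_or_mem (h : IsPointSeparation z U V) (hx : x ≠ z) : x ∈ U ∨ x ∈ V := by
  have hxz : x ∈ ({z}ᶜ : Set X) := hx
  rwa [← h.union_eq] at hxz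

theorem ne_of_mem_left (h : IsPointSeparation z U V) (hx : x ∈ U) : x ≠ z := by
  have hxz : x ∈ U ∪ V := Or.inl hx
  rwa [h.union_eq] at hxz

theorem notMem_left (h : IsPointSeparation z U V) : z ∉ U :=
  fun hz => h.ne_of_mem_left hz rfl

theorem notMem_right_of_mem_left (h : IsPointSeparation z U V) (hx : x ∈ U) : x ∉ V :=
  fun hx' => disjoint_left.1 h.disjoint hx hx'

theorem compl_right (h : IsPointSeparation z U V) : Vᶜ = insert z U := by
  ext x
  constructor
  · intro hx
    by_cases hxz : x = z
    · exact Or.inl hxz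
    · exact Or.inr ((h.mem_or_mem hxz).resolve_right hx)
  · rintro (rfl | hx)
    · exact h.symm.notMem_left
    · exact h.notMem_right_of_mem_left hx

theorem isClosed_insert (h : IsPointSeparation z U V) : IsClosed (insert z U) := by
  rw [← h.compl_right]
  exact h.isOpen_right.isClosed_compl

theorem subset_left (h : IsPointSeparation z U V) (hS : IsPreconnected S) (hz : z ∉ S)
    (hx : x ∈ S) (hxU : x ∈ U) : S ⊆ U := by
  refine hS.subset_left_of_subset_union h.isOpen_left h.isOpen_right h.disjoint ?_ ⟨x, hx, hxU⟩
  rw [h.union_eq]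
  exact subset_compl_singleton_iff.2 hz

theorem isPreconnected_insert [PreconnectedSpace X] (h : IsPointSeparation z U V) :
    IsPreconnected (insert z U) := by
  have key : ∀ u v : Set X, IsClosed u → IsClosed v → insert z U ⊆ u ∪ v → Disjoint u v →
      z ∈ u → insert z U ⊆ u := by
    intro u v hu hv huv hd hzu
    have hzv : z ∉ v := disjoint_left.1 hd hzu
    have hcompl : v ∩ insert z U = (u ∪ insert z V)ᶜ := by
      rw [← h.symm.compl_right]
      ext x
      simp only [mem_inter_iff, mem_compl_iff, mem_union, not_or, not_not]
      constructor
      · rintro ⟨hxv, rfl | hxU⟩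
        · exact absurd hxv hzv
        · exact ⟨disjoint_right.1 hd hxv, hxU⟩
      · rintro ⟨hxu, hxU⟩
        exact ⟨(huv (Or.inr hxU)).resolve_left hxu, Or.inr hxU⟩
    have hclopen : IsClopen (v ∩ insert z U) := by
      refine ⟨hv.inter h.isClosed_insert, ?_⟩
      rw [hcompl]
      exact (hu.union h.symm.isClosed_insert).isOpen_compl
    rcases isClopen_iff.1 hclopen with he | he
    · intro x hx
      rcases huv hx with hxu | hxv
      · exact hxu
      · exact (he.subset ⟨hxv, hx⟩).elim
    · exact absurd (he.symm.subset (mem_univ z)).1 hzv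
  rw [isPreconnected_iff_subset_of_fully_disjoint_closed h.isClosed_insert]
  intro u v hu hv huv hd
  rcases huv (mem_insert z U) with hzu | hzv
  · exact Or.inl (key u v hu hv huv hd hzu)
  · exact Or.inr (key v u hv hu (by rwa [union_comm]) hd.symm hzv)

theorem insert_subset_left [PreconnectedSpace X] (hx : IsPointSeparation x U V)
    (hy : IsPointSeparation y U' V') (hyU : y ∉ insert x U) (hz : z ∈ insert x U)
    (hz' : z ∈ U') : insert x U ⊆ U' :=
  hy.subset_left hx.isPreconnected_insert hyU hz hz'

end IsPointSeparation

theorem exists_isPointSeparation_of_not_isConnected {X : Type*} [TopologicalSpace X] [T1Space X]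
    [Nontrivial X] {z : X} (hz : ¬ IsConnected ({z}ᶜ : Set X)) :
    ∃ U V : Set X, IsPointSeparation z U V ∧ U.Nonempty ∧ V.Nonempty := by
  have hne : ({z}ᶜ : Set X).Nonempty := exists_ne z
  have hpre : ¬ IsPreconnected ({z}ᶜ : Set X) := fun h => hz ⟨hne, h⟩
  simp only [IsPreconnected, not_forall] at hpre
  obtain ⟨u, v, hu, hv, huv, hnu, hnv, hdisj⟩ := hpre
  refine ⟨{z}ᶜ ∩ u, {z}ᶜ ∩ v, ⟨isOpen_compl_singleton.inter hu, isOpen_compl_singleton.inter hv,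
    ?_, ?_⟩, hnu, hnv⟩
  · rw [disjoint_left]
    rintro x ⟨hx, hxu⟩ ⟨-, hxv⟩
    exact hdisj ⟨x, hx, hxu, hxv⟩
  · rw [← inter_union_distrib_left]
    exact inter_eq_left.2 huv

/-- Each side of a separation by a cut point of a compact connected space contains a non-cut
point. -/
theorem IsPointSeparation.exists_isConnected_compl_singleton {X : Type*} [TopologicalSpace X]
    [T1Space X] [CompactSpace X] [PreconnectedSpace X] [Nontrivial X] {z : X} {U V : Set X}
    (h : IsPointSeparation z U V) (hU : U.Nonempty) :
    ∃ x ∈ U, IsConnected ({x}ᶜ : Set X) := by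
  by_contra! hcut
  have hsep : ∀ x ∈ U, ∃ P Q : Set X, IsPointSeparation x P Q ∧ P.Nonempty ∧ z ∈ Q := by
    intro x hx
    obtain ⟨P, Q, hPQ, hP, hQ⟩ := exists_isPointSeparation_of_not_isConnected (hcut x hx)
    rcases hPQ.mem_or_mem (h.ne_of_mem_left hx).symm with hz | hz
    · exact ⟨Q, P, hPQ.symm, hQ, hz⟩
    · exact ⟨P, Q, hPQ, hP, hz⟩
  choose! P Q hPQ hP hQ using hsep
  have hsub : ∀ x ∈ U, insert x (P x) ⊆ U := by
    intro x hx
    refine (hPQ x hx).insert_subset_left h ?_ (mem_insert _ _) hx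
    rw [← (hPQ x hx).compl_right]
    exact not_not.2 (hQ x hx)
  have hnest : ∀ x ∈ U, ∀ y ∈ P x, insert y (P y) ⊆ P x := by
    intro x hx y hy
    have hyU : y ∈ U := hsub x hx (Or.inr hy)
    have hQsub : insert x (Q x) ⊆ Q y := by
      refine (hPQ x hx).symm.insert_subset_left (hPQ y hyU).symm ?_ (Or.inr (hQ x hx)) (hQ y hyU)
      rw [← (hPQ x hx).symm.compl_right]
      exact not_not.2 hy
    rw [← (hPQ y hyU).compl_right, compl_subset_comm, (hPQ x hx).symm.compl_right]
    exact hQsub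
  obtain ⟨m, hm⟩ := zorn_superset ((fun x => insert x (P x)) '' U) (by
    intro c hc hchain
    rcases c.eq_empty_or_nonempty with rfl | hne
    · exact ⟨_, mem_image_of_mem _ hU.some_mem, fun _ hs => hs.elim⟩
    have hclosed : ∀ s ∈ c, IsClosed s := by
      intro s hs
      obtain ⟨x, hx, rfl⟩ := hc hs
      exact (hPQ x hx).isClosed_insert
    obtain ⟨y, hy⟩ : (⋂₀ c).Nonempty := by
      have : Nonempty c := hne.to_subtype
      have hdir : DirectedOn (· ⊇ ·) c := fun s hs t ht =>
        (hchain.total hs ht).elim (fun hst => ⟨s, hs, Subset.rfl, hst⟩)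
          fun hts => ⟨t, ht, hts, Subset.rfl⟩
      refine IsCompact.nonempty_sInter_of_directed_nonempty_isCompact_isClosed hdir ?_
        (fun s hs => (hclosed s hs).isCompact) hclosed
      intro s hs
      obtain ⟨x, hx, rfl⟩ := hc hs
      exact insert_nonempty _ _
    obtain ⟨s₀, hs₀⟩ := hne
    obtain ⟨x₀, hx₀, rfl⟩ := hc hs₀
    refine ⟨_, mem_image_of_mem _ (hsub x₀ hx₀ (hy _ hs₀)), ?_⟩
    intro s hs
    obtain ⟨x, hx, rfl⟩ := hc hs
    rcases hy _ hs with rfl | hyx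
    · exact Subset.rfl
    · exact (hnest x hx y hyx).trans (subset_insert _ _))
  obtain ⟨x, hx, rfl⟩ := hm.prop
  obtain ⟨y, hy⟩ := hP x hx
  have hle : insert x (P x) ⊆ insert y (P y) :=
    hm.le_of_le (mem_image_of_mem _ (hsub x hx (Or.inr hy)))
      ((hnest x hx y hy).trans (subset_insert _ _))
  exact (hPQ x hx).notMem_left (hnest x hx y hy (hle (mem_insert _ _)))

/-- A space in which the points other than `a` and `b` separate `a` from `b` has a linear order
with open rays. -/
theorem exists_linearOrder_isOpen_Iio_Ioi {X : Type*} [TopologicalSpace X] [PreconnectedSpace X]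
    {a b : X} {L R : X → Set X} (h : ∀ z, IsPointSeparation z (L z) (R z))
    (ha : ∀ z, z ≠ a → a ∈ L z) (hb : ∀ z, z ≠ b → b ∈ R z) :
    ∃ _ : LinearOrder X, (∀ x : X, IsOpen (Iio x)) ∧ ∀ x : X, IsOpen (Ioi x) := by
  classical
  have hR : ∀ x y, x ∈ L y → y ∈ R x := by
    intro x y hxy
    have hbmem : b ∈ insert y (R y) := by
      by_cases hy : y = b
      · exact Or.inl hy.symm
      · exact Or.inr (hb y hy)
    have hxmem : x ∉ insert y (R y) := by
      rw [← (h y).symm.compl_right]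
      exact not_not.2 hxy
    exact (h y).symm.insert_subset_left (h x).symm hxmem hbmem
      (hb x fun hx => hxmem (hx ▸ hbmem)) (mem_insert _ _)
  have hL : ∀ x y, y ∈ R x → insert x (L x) ⊆ L y := by
    intro x y hxy
    have hamem : a ∈ insert x (L x) := by
      by_cases hx : x = a
      · exact Or.inl hx.symm
      · exact Or.inr (ha x hx)
    have hymem : y ∉ insert x (L x) := by
      rw [← (h x).compl_right]
      exact not_not.2 hxy
    exact (h x).insert_subset_left (h y) hymem hamem (ha y fun hy => hymem (hy ▸ hamem))
  have hiff : ∀ x y, x ∈ L y ↔ y ∈ R x := fun x y => ⟨hR x y, fun hy => hL x y hy (mem_insert _ _)⟩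
  have htrans : ∀ x y z, x ∈ L y → y ∈ L z → x ∈ L z := fun x y z hxy hyz =>
    hL y z (hR y z hyz) (Or.inr hxy)
  have : IsStrictTotalOrder X (fun x y => x ∈ L y) :=
    { irrefl := fun x => (h x).notMem_left
      trans := htrans
      trichotomous := fun x y hxy hyx => by
        by_contra hne
        rcases (h y).mem_or_mem hne with hx | hx
        · exact hxy hx
        · exact hyx ((hiff y x).2 hx) }
  refine ⟨linearOrderOfSTO (fun x y => x ∈ L y), fun x => (h x).isOpen_left, fun x => ?_⟩
  convert (h x).isOpen_right using 1
  ext y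
  exact hiff x y

section LinearOrder

variable {A : Type*} [LinearOrder A]

theorem Metric.continuous_infDist_Iic [MetricSpace A] [CompactSpace A] [DenselyOrdered A]
    [ClosedIicTopology A] [ClosedIciTopology A] (c : A) :
    Continuous fun x : A => Metric.infDist c (Iic x) := by
  have hne : ∀ x : A, (Iic x).Nonempty := fun x => nonempty_Iic
  rw [continuous_iff_continuousAt]
  intro x
  rw [ContinuousAt, tendsto_order]
  constructor
  · intro r hr
    obtain ⟨s, hrs, hs⟩ := exists_between hr
    have hlt : ∀ y ∈ Metric.closedBall c s, x < y := by
      intro y hy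
      by_contra! hyx
      have := Metric.infDist_le_dist_of_mem (x := c) (show y ∈ Iic x from hyx)
      rw [Metric.mem_closedBall, dist_comm] at hy
      linarith
    rcases (Metric.closedBall c s).eq_empty_or_nonempty with he | hn
    · refine Filter.Eventually.of_forall fun x' => ?_
      have : s < 0 := Metric.closedBall_eq_empty.1 he
      exact (hrs.trans this).trans_le Metric.infDist_nonneg
    · obtain ⟨m, hm, hmin⟩ := (Metric.isClosed_closedBall (x := c) (ε := s)).isCompact.exists_isLeast hn
      filter_upwards [isOpen_Iio.mem_nhds (hlt m hm)] with x' hx'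
      refine hrs.trans_le ((Metric.le_infDist (hne x')).2 fun y hy => ?_)
      by_contra! hys
      rw [dist_comm] at hys
      exact absurd (hmin (Metric.mem_closedBall.2 hys.le)) (not_le.2 (lt_of_le_of_lt hy hx'))
  · intro r hr
    obtain ⟨y, hy, hyr⟩ := (Metric.infDist_lt_iff (hne x)).1 hr
    rcases (show y ≤ x from hy).eq_or_lt with rfl | hlt
    · have hmem : y ∈ Metric.ball c r := by rwa [Metric.mem_ball, dist_comm]
      filter_upwards [Metric.isOpen_ball.mem_nhds hmem] with x' hx'
      rw [Metric.mem_ball, dist_comm] at hx'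
      exact (Metric.infDist_lt_iff (hne x')).2 ⟨x', self_mem_Iic, hx'⟩
    · filter_upwards [isOpen_Ioi.mem_nhds hlt] with x' hx'
      exact (Metric.infDist_lt_iff (hne x')).2 ⟨y, (show y < x' from hx').le, hyr⟩

theorem denselyOrdered_of_preconnectedSpace_of_closedIic_closedIci [TopologicalSpace A]
    [PreconnectedSpace A] [ClosedIicTopology A] [ClosedIciTopology A] : DenselyOrdered A := by
  refine ⟨fun p q hpq => ?_⟩
  by_contra! hgap
  have heq : Iic p = Iio q := by
    ext x
    exact ⟨fun hx => lt_of_le_of_lt hx hpq, fun hx => not_lt.1 fun hpx => (hgap x hpx).not_gt hx⟩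
  have hclopen : IsClopen (Iic p) := ⟨isClosed_Iic, heq ▸ isOpen_Iio⟩
  rcases isClopen_iff.1 hclopen with he | he
  · exact he.subset (self_mem_Iic (a := p))
  · exact not_le.2 hpq (he.symm.subset (mem_univ q))

theorem exists_continuous_strictAnti [MetricSpace A] [CompactSpace A] [PreconnectedSpace A]
    [ClosedIicTopology A] [ClosedIciTopology A] : ∃ f : A → ℝ, Continuous f ∧ StrictAnti f := by
  have := denselyOrdered_of_preconnectedSpace_of_closedIic_closedIci (A := A)
  rcases isEmpty_or_nonempty A with _ | _
  · exact ⟨isEmptyElim, continuous_of_const isEmptyElim, fun x => isEmptyElim x⟩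
  let c : ℕ → A := TopologicalSpace.denseSeq A
  let g : ℕ → A → ℝ := fun n x => (1 / 2) ^ n * Metric.infDist (c n) (Iic x)
  have hbound : ∀ n x, ‖g n x‖ ≤ (1 / 2) ^ n * Metric.diam (univ : Set A) := by
    intro n x
    rw [Real.norm_of_nonneg (mul_nonneg (by positivity) Metric.infDist_nonneg)]
    refine mul_le_mul_of_nonneg_left ?_ (by positivity)
    exact (Metric.infDist_le_dist_of_mem self_mem_Iic).trans
      (Metric.dist_le_diam_of_mem isCompact_univ.isBounded (mem_univ _) (mem_univ _))
  have hsum : Summable fun n : ℕ => (1 / 2 : ℝ) ^ n * Metric.diam (univ : Set A) :=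
    summable_geometric_two.mul_right _
  have hg : ∀ x, Summable fun n => g n x := fun x => hsum.of_norm_bounded fun n => hbound n x
  refine ⟨fun x => ∑' n, g n x, continuous_tsum
    (fun n => continuous_const.mul (Metric.continuous_infDist_Iic (c n))) hsum hbound, ?_⟩
  intro p q hpq
  obtain ⟨y, hy⟩ := exists_between hpq
  obtain ⟨n, hn⟩ := (TopologicalSpace.denseRange_denseSeq A).exists_mem_open
    (isOpen_Ioi.inter isOpen_Iio : IsOpen (Ioi p ∩ Iio q)) ⟨y, hy⟩
  refine (hg q).tsum_lt_tsum (i := n) (fun k => ?_) ?_ (hg p)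
  · exact mul_le_mul_of_nonneg_left
      (Metric.infDist_le_infDist_of_subset (Iic_subset_Iic.2 hpq.le) nonempty_Iic) (by positivity)
  · refine mul_lt_mul_of_pos_left ?_ (by positivity)
    rw [Metric.infDist_zero_of_mem (show c n ∈ Iic q from (show c n < q from hn.2).le)]
    exact (isClosed_Iic.notMem_iff_infDist_pos nonempty_Iic).1 (not_le.2 hn.1)

end LinearOrder

/-- A nondegenerate compact connected space that injects continuously into the line is an arc. -/
theorem nonempty_homeomorph_unitInterval_of_injective {X : Type*} [TopologicalSpace X]
    [CompactSpace X] [ConnectedSpace X] [Nontrivial X] {f : X → ℝ} (hf : Continuous f)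
    (hinj : Function.Injective f) : Nonempty (X ≃ₜ unitInterval) := by
  have hemb : IsClosedEmbedding f := hf.isClosedEmbedding hinj
  have hrange : range f = Icc (sInf (range f)) (sSup (range f)) :=
    eq_Icc_of_connected_compact (isConnected_range hf) (isCompact_range hf)
  obtain ⟨x, y, hxy⟩ := exists_pair_ne X
  have hlt : sInf (range f) < sSup (range f) := by
    by_contra! hle
    have hsub : (range f).Subsingleton := by
      rw [hrange]
      exact subsingleton_Icc_of_ge hle
    exact hxy (hinj (hsub (mem_range_self x) (mem_range_self y)))
  exact ⟨(hemb.isEmbedding.toHomeomorph.trans (Homeomorph.setCongr hrange)).trans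
    (iccHomeoI _ _ hlt)⟩

/-- **Moore's characterization of the arc.** A compact connected metric space with at least
two points and exactly two non-cut points is homeomorphic to the closed interval `[0,1]`.
(Here `z` is a cut point when `A \ {z}` is disconnected, and a non-cut point otherwise.) -/
theorem moore_arc_characterization (A : Type u) [MetricSpace A] [CompactSpace A]
    [ConnectedSpace A] [Nontrivial A]
    (hnc : ∃ a b : A, a ≠ b ∧ {z : A | IsConnected ({z}ᶜ : Set A)} = {a, b}) :
    Nonempty (A ≃ₜ unitInterval) := by
  obtain ⟨a, b, hab, hset⟩ := hnc
  have hmem : ∀ z : A, IsConnected ({z}ᶜ : Set A) ↔ z = a ∨ z = b := fun z => Set.ext_iff.1 hset z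
  have hsep : ∀ z : A, ∃ L R : Set A,
      IsPointSeparation z L R ∧ (z ≠ a → a ∈ L) ∧ (z ≠ b → b ∈ R) := by
    intro z
    by_cases hza : z = a
    · subst hza
      exact ⟨∅, {z}ᶜ, ⟨isOpen_empty, isOpen_compl_singleton, empty_disjoint _, empty_union _⟩,
        fun h => absurd rfl h, fun h => h.symm⟩
    by_cases hzb : z = b
    · subst hzb
      exact ⟨{z}ᶜ, ∅, ⟨isOpen_compl_singleton, isOpen_empty, disjoint_empty _, union_empty _⟩,
        fun h => h.symm, fun h => absurd rfl h⟩
    obtain ⟨U, V, hUV, hU, hV⟩ := exists_isPointSeparation_of_not_isConnected (z := z)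
      fun h => ((hmem z).1 h).elim hza hzb
    obtain ⟨x, hx, hxc⟩ := hUV.exists_isConnected_compl_singleton hU
    obtain ⟨y, hy, hyc⟩ := hUV.symm.exists_isConnected_compl_singleton hV
    have hxy : x ≠ y := fun h => hUV.notMem_right_of_mem_left hx (h ▸ hy)
    rcases (hmem x).1 hxc with rfl | rfl <;> rcases (hmem y).1 hyc with rfl | rfl
    · exact absurd rfl hxy
    · exact ⟨U, V, hUV, fun _ => hx, fun _ => hy⟩
    · exact ⟨V, U, hUV.symm, fun _ => hy, fun _ => hx⟩
    · exact absurd rfl hxy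
  choose L R hLR ha hb using hsep
  obtain ⟨_, hIio, hIoi⟩ := exists_linearOrder_isOpen_Iio_Ioi hLR ha hb
  have : ClosedIicTopology A := ⟨fun x => by
    rw [← compl_Ioi]
    exact (hIoi x).isClosed_compl⟩
  have : ClosedIciTopology A := ⟨fun x => by
    rw [← compl_Iio]
    exact (hIio x).isClosed_compl⟩
  obtain ⟨f, hf, hanti⟩ := exists_continuous_strictAnti (A := A)
  exact nonempty_homeomorph_unitInterval_of_injective hf hanti.injective
end
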